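/- arXiv:1807.03471 — 13 statements merged into one kernel-verified Lean document; each statement's English description precedes it below -/
import Mathlib

section
/- (Lemma 2.3) Let A be a densely defined closed operator on a complex Hilbert space H with adjoint A*. Let M ⊂ D(A*) be a linear subspace such that ker(A*) ∩ cl(M) = {0} and {A*φ : φ ∈ cl(M)} ∩ D(A) = {0}, where cl(M) is the closure of M with respect to the graph norm of A*. Then the operator A_M (with domain D(A) ∔ {A*φ : φ ∈ M}, acting by f + A*φ ↦ Af − φ) is closable, and its closure equals A_{cl(M)}, the operator with domain D(A) ∔ {A*φ : φ ∈ cl(M)} acting by f + A*φ ↦ Af − φ. -/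
/- STATEMENT 3 (Lemma 2.3): If `cl(M)` (graph-norm closure of `M` in `D(A*)`) satisfies
`ker A* ∩ cl(M) = {0}` and `{A*φ : φ ∈ cl(M)} ∩ D(A) = {0}`, then the extension
`A_M : f + A*φ ↦ Af - φ` is closable and its closure is `A_{cl(M)}`. -/

/-- `B` is the extension `A_N` of `A`: domain `D(A) ∔ {A*φ : φ ∈ N}`,
acting by `f + A*φ ↦ A f - φ`. -/
def IsExtAM {H : Type*} [NormedAddCommGroup H] [InnerProductSpace ℂ H] [CompleteSpace H]
    (A : H →ₗ.[ℂ] H) (N : Submodule ℂ A.adjoint.domain) (B : H →ₗ.[ℂ] H) : Prop :=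
  B.domain = A.domain ⊔ N.map A.adjoint.toFun ∧
  ∀ (f : A.domain) (φ : A.adjoint.domain), φ ∈ N →
    ∀ hmem : (f : H) + A.adjoint φ ∈ B.domain,
      B ⟨(f : H) + A.adjoint φ, hmem⟩ = A f - (φ : H)

/-- A closed subspace of `H × H` is the range of a continuous projection that vanishes on the
vectors orthogonal to it for the Hilbert sum inner product. -/
theorem exists_projection_prod
    {H : Type*} [NormedAddCommGroup H] [InnerProductSpace ℂ H] [CompleteSpace H]
    (G : Submodule ℂ (H × H)) (hG : IsClosed (G : Set (H × H))) :
    ∃ Q : H × H →L[ℂ] H × H, (∀ x, Q x ∈ G) ∧ (∀ x ∈ G, Q x = x) ∧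
      ∀ x, (∀ g ∈ G, inner ℂ g.1 x.1 + inner ℂ g.2 x.2 = 0) → Q x = 0 := by
  let e := WithLp.prodContinuousLinearEquiv 2 ℂ H H
  let K : Submodule ℂ (WithLp 2 (H × H)) := G.comap e.toLinearEquiv.toLinearMap
  have hK : IsClosed (K : Set (WithLp 2 (H × H))) := hG.preimage e.continuous
  have : CompleteSpace K := hK.completeSpace_coe
  refine ⟨e.toContinuousLinearMap ∘L K.starProjection ∘L e.symm.toContinuousLinearMap,
    fun x => ?_, fun x hx => ?_, fun x hx => ?_⟩
  · exact K.starProjection_apply_mem (e.symm x)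
  · have hmem : e.symm x ∈ K := by
      change e (e.symm x) ∈ G
      simpa using hx
    have h : K.starProjection (e.symm x) = e.symm x :=
      Submodule.starProjection_eq_self_iff.mpr hmem
    simp [h]
  · have hmem : e.symm x ∈ Kᗮ := by
      rw [Submodule.mem_orthogonal]
      intro u hu
      rw [WithLp.prod_inner_apply]
      exact hx (e u) hu
    have h : K.starProjection (e.symm x) = 0 :=
      (Submodule.starProjection_apply_eq_zero_iff K).mpr hmem
    simp [h]

/-- The closure of the sum of a closed subspace `G` of `H × H` and a subspace `V` orthogonal to it
is the sum of `G` and the closure of `V`. -/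
theorem topologicalClosure_sup_of_orthogonal
    {H : Type*} [NormedAddCommGroup H] [InnerProductSpace ℂ H] [CompleteSpace H]
    (G V : Submodule ℂ (H × H)) (hG : IsClosed (G : Set (H × H)))
    (hGV : ∀ g ∈ G, ∀ v ∈ V, inner ℂ g.1 v.1 + inner ℂ g.2 v.2 = 0) :
    (G ⊔ V).topologicalClosure = G ⊔ V.topologicalClosure := by
  apply le_antisymm
  · obtain ⟨Q, hQmem, hQid, hQzero⟩ := exists_projection_prod G hG
    intro z hz
    have hsub : z - Q z ∈ V.topologicalClosure := by
      refine map_mem_closure (f := fun x => x - Q x) (by fun_prop) hz ?_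
      intro x hx
      obtain ⟨g, hg, v, hv, rfl⟩ := Submodule.mem_sup.mp hx
      have hQv : Q v = 0 := hQzero v fun g hg => hGV g hg v hv
      simpa [hQid g hg, hQv] using hv
    exact Submodule.mem_sup.mpr ⟨Q z, hQmem z, z - Q z, hsub, by abel⟩
  · exact sup_le (le_sup_left.trans (Submodule.le_topologicalClosure _))
      (Submodule.topologicalClosure_mono le_sup_right)

/-- The map `φ ↦ (T φ, -φ)` from the domain of `T` to the rotated graph of `T`. -/
def rotatedGraphMap {H : Type*} [NormedAddCommGroup H] [InnerProductSpace ℂ H]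
    (T : H →ₗ.[ℂ] H) : T.domain →ₗ[ℂ] H × H :=
  T.toFun.prod (-T.domain.subtype)

theorem rotatedGraphMap_apply {H : Type*} [NormedAddCommGroup H] [InnerProductSpace ℂ H]
    (T : H →ₗ.[ℂ] H) (φ : T.domain) : rotatedGraphMap T φ = (T φ, -(φ : H)) :=
  rfl

theorem IsExtAM.graph_eq
    {H : Type*} [NormedAddCommGroup H] [InnerProductSpace ℂ H] [CompleteSpace H]
    {A : H →ₗ.[ℂ] H} {N : Submodule ℂ A.adjoint.domain} {B : H →ₗ.[ℂ] H}
    (hB : IsExtAM A N B) :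
    B.graph = A.graph ⊔ N.map (rotatedGraphMap A.adjoint) := by
  obtain ⟨hdom, happ⟩ := hB
  ext ⟨x, y⟩
  rw [Submodule.mem_sup]
  constructor
  · intro h
    obtain ⟨⟨b, hb⟩, rfl, rfl⟩ := (LinearPMap.mem_graph_iff B).mp h
    have hb' := hb
    rw [hdom, Submodule.mem_sup] at hb'
    obtain ⟨f, hf, _, ⟨φ, hφ, rfl⟩, rfl⟩ := hb'
    refine ⟨_, A.mem_graph ⟨f, hf⟩, _, Submodule.mem_map_of_mem hφ, ?_⟩
    have := happ ⟨f, hf⟩ φ hφ hb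
    rw [rotatedGraphMap_apply]
    refine Prod.ext rfl ?_
    change A ⟨f, hf⟩ + -(φ : H) = _
    rw [← sub_eq_add_neg]
    exact this.symm
  · rintro ⟨⟨g₁, g₂⟩, hg, _, ⟨φ, hφ, rfl⟩, h⟩
    obtain ⟨f, rfl, rfl⟩ := (LinearPMap.mem_graph_iff A).mp hg
    have hmem : (f : H) + A.adjoint φ ∈ B.domain := by
      rw [hdom]
      exact Submodule.add_mem_sup f.2 (Submodule.mem_map_of_mem hφ)
    rw [← h, rotatedGraphMap_apply, Prod.mk_add_mk, ← sub_eq_add_neg, ← happ f φ hφ hmem]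
    exact B.mem_graph ⟨_, hmem⟩

theorem inner_graph_rotatedGraph_adjoint
    {H : Type*} [NormedAddCommGroup H] [InnerProductSpace ℂ H] [CompleteSpace H]
    {A : H →ₗ.[ℂ] H} (hA : Dense (A.domain : Set H)) (f : A.domain) (φ : A.adjoint.domain) :
    inner ℂ (f : H) (A.adjoint φ) + inner ℂ (A f) (-(φ : H)) = 0 := by
  rw [inner_neg_right, ← (LinearPMap.adjoint_isFormalAdjoint hA).symm f φ, add_neg_cancel]

/-- For a closed operator `T`, passing to the rotated graph commutes with graph-norm closure. -/
theorem map_rotatedGraphMap_eq_topologicalClosure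
    {H : Type*} [NormedAddCommGroup H] [InnerProductSpace ℂ H]
    {T : H →ₗ.[ℂ] H} (hT : T.IsClosed) (M Mcl : Submodule ℂ T.domain)
    (hMcl : (Mcl : Set T.domain) = {φ : T.domain | ((φ : H), T φ) ∈
      closure ((fun ψ : T.domain => ((ψ : H), T ψ)) '' M)}) :
    Mcl.map (rotatedGraphMap T) = (M.map (rotatedGraphMap T)).topologicalClosure := by
  have hmem (φ : T.domain) : φ ∈ Mcl ↔ ((φ : H), T φ) ∈
      closure ((fun ψ : T.domain => ((ψ : H), T ψ)) '' M) := by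
    rw [← SetLike.mem_coe, hMcl, Set.mem_ofPred_eq]
  apply le_antisymm
  · rintro _ ⟨φ, hφ, rfl⟩
    refine map_mem_closure (f := fun p : H × H => (p.2, -p.1)) (by fun_prop)
      ((hmem φ).mp hφ) ?_
    rintro _ ⟨ψ, hψ, rfl⟩
    exact Submodule.mem_map_of_mem (f := rotatedGraphMap T) hψ
  · rintro ⟨x, y⟩ hz
    have hcl : (-y, x) ∈ closure ((fun ψ : T.domain => ((ψ : H), T ψ)) '' M) := by
      refine map_mem_closure (f := fun p : H × H => (-p.2, p.1)) (by fun_prop) hz ?_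
      rintro _ ⟨ψ, hψ, rfl⟩
      exact ⟨ψ, hψ, by simp [rotatedGraphMap_apply]⟩
    have hgraph : (-y, x) ∈ T.graph := by
      refine closure_minimal ?_ hT hcl
      rintro _ ⟨ψ, -, rfl⟩
      exact T.mem_graph ψ
    obtain ⟨φ, hφ₁, hφ₂⟩ := (LinearPMap.mem_graph_iff T).mp hgraph
    refine ⟨φ, (hmem φ).mpr (by simpa [hφ₁, hφ₂] using hcl), ?_⟩
    rw [rotatedGraphMap_apply, hφ₁, hφ₂, neg_neg]

theorem statement3
    {H : Type*} [NormedAddCommGroup H] [InnerProductSpace ℂ H] [CompleteSpace H]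
    (A : H →ₗ.[ℂ] H) (hA : Dense (A.domain : Set H)) (hAclosed : A.IsClosed)
    (M Mcl : Submodule ℂ A.adjoint.domain)
    -- `Mcl` is the closure of `M` with respect to the graph norm of `A*`:
    (hMcl : (Mcl : Set A.adjoint.domain) =
      {φ : A.adjoint.domain | ((φ : H), A.adjoint φ) ∈
        closure ((fun ψ : A.adjoint.domain => ((ψ : H), A.adjoint ψ)) '' M)})
    (hker : ∀ φ : A.adjoint.domain, φ ∈ Mcl → A.adjoint φ = 0 → φ = 0)
    (hran : ∀ φ : A.adjoint.domain, φ ∈ Mcl →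
      A.adjoint φ ∈ A.domain → A.adjoint φ = 0)
    (B B' : H →ₗ.[ℂ] H)
    (hB : IsExtAM A M B) (hB' : IsExtAM A Mcl B') :
    B.IsClosable ∧ B.closure = B' := by
  have hgraph : B.graph.topologicalClosure = B'.graph := by
    rw [hB.graph_eq, hB'.graph_eq, map_rotatedGraphMap_eq_topologicalClosure
      (LinearPMap.adjoint_isClosed hA) M Mcl hMcl]
    refine topologicalClosure_sup_of_orthogonal _ _ hAclosed ?_
    rintro ⟨g₁, g₂⟩ hg _ ⟨φ, -, rfl⟩
    obtain ⟨f, rfl, rfl⟩ := (LinearPMap.mem_graph_iff A).mp hg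
    exact inner_graph_rotatedGraph_adjoint hA f φ
  have hclosable : B.IsClosable := ⟨B', hgraph⟩
  refine ⟨hclosable, LinearPMap.eq_of_eq_graph ?_⟩
  rw [← hclosable.graph_closure_eq_closure_graph, hgraph]
end

section
/- (Lemma 2.8) Let A be a densely defined closed operator on a complex Hilbert space H with adjoint A*, and let M ⊂ D(A*) satisfy ker(A*) ∩ M = {0} and {A*φ : φ ∈ M} ∩ D(A) = {0}. Let A_M be the operator with domain D(A) ∔ {A*φ : φ ∈ M} acting by f + A*φ ↦ Af − φ, and let C_M be the restriction of A* to the domain {f ∈ D(A*) : ⟨f, φ⟩ + ⟨A*f, A*φ⟩ = 0 for all φ ∈ M}. Then the adjoint of A_M equals C_M, i.e. A_M* = C_M. -/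
/- STATEMENT 5 (Lemma 2.8): With `M ⊆ D(A*)` satisfying `ker A* ∩ M = {0}` and
`{A*φ : φ ∈ M} ∩ D(A) = {0}`, the adjoint of `A_M` equals `C_M`, the restriction of
`A*` to `{f ∈ D(A*) : ⟪f, φ⟫ + ⟪A*f, A*φ⟫ = 0 for all φ ∈ M}`. -/

open scoped ComplexInnerProductSpace

/-- `C` is the operator `C_M`: the restriction of `A*` to
`{f ∈ D(A*) : ⟪f, φ⟫ + ⟪A*f, A*φ⟫ = 0 ∀ φ ∈ M}`. -/
def IsCM {H : Type*} [NormedAddCommGroup H] [InnerProductSpace ℂ H] [CompleteSpace H]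
    (A : H →ₗ.[ℂ] H) (M : Submodule ℂ A.adjoint.domain) (C : H →ₗ.[ℂ] H) : Prop :=
  C ≤ A.adjoint ∧
  ∀ x : H, x ∈ C.domain ↔ ∃ hx : x ∈ A.adjoint.domain,
    ∀ φ : A.adjoint.domain, φ ∈ M →
      ⟪x, (φ : H)⟫ + ⟪A.adjoint ⟨x, hx⟩, A.adjoint φ⟫ = 0

namespace IsExtAM

variable {H : Type*} [NormedAddCommGroup H] [InnerProductSpace ℂ H] [CompleteSpace H]
  {A B : H →ₗ.[ℂ] H} {N : Submodule ℂ A.adjoint.domain}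

theorem add_mem_domain (h : IsExtAM A N B) (f : A.domain) {φ : A.adjoint.domain} (hφ : φ ∈ N) :
    (f : H) + A.adjoint φ ∈ B.domain := by
  rw [h.1]
  exact Submodule.add_mem_sup f.2 (Submodule.mem_map_of_mem hφ)

theorem exists_eq_add (h : IsExtAM A N B) (x : B.domain) :
    ∃ (f : A.domain) (φ : A.adjoint.domain), φ ∈ N ∧
      (x : H) = f + A.adjoint φ ∧ B x = A f - (φ : H) := by
  obtain ⟨x, hx⟩ := x
  have hx' := hx
  rw [h.1] at hx'
  obtain ⟨f, hf, _, ⟨φ, hφ, rfl⟩, rfl⟩ := Submodule.mem_sup.1 hx'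
  exact ⟨⟨f, hf⟩, φ, hφ, rfl, h.2 ⟨f, hf⟩ φ hφ hx⟩

theorem le (h : IsExtAM A N B) : A ≤ B := by
  refine ⟨h.1 ▸ le_sup_left, ?_⟩
  rintro f ⟨_, hg⟩ rfl
  have := h.2 f 0 N.zero_mem (h.add_mem_domain f N.zero_mem)
  simpa using this.symm

theorem dense_domain (h : IsExtAM A N B) (hA : Dense (A.domain : Set H)) :
    Dense (B.domain : Set H) :=
  hA.mono h.le.1

/-- The adjoint of the extension is contained in the adjoint of the original operator. -/
theorem adjoint_le_adjoint (h : IsExtAM A N B) (hA : Dense (A.domain : Set H)) :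
    B.adjoint ≤ A.adjoint := by
  refine LinearPMap.IsFormalAdjoint.le_adjoint hA fun f x => ?_
  rw [h.le.2 (y := ⟨f, h.le.1 f.2⟩) rfl]
  exact (LinearPMap.adjoint_isFormalAdjoint (h.dense_domain hA)).symm ⟨f, h.le.1 f.2⟩ x

theorem inner_add_inner_adjoint_eq_zero (h : IsExtAM A N B) (hA : Dense (A.domain : Set H))
    (x : B.adjoint.domain) {φ : A.adjoint.domain} (hφ : φ ∈ N) :
    ⟪(x : H), (φ : H)⟫ + ⟪B.adjoint x, A.adjoint φ⟫ = 0 := by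
  have hmem := h.add_mem_domain 0 hφ
  have key := LinearPMap.adjoint_isFormalAdjoint (h.dense_domain hA) x ⟨_, hmem⟩
  rw [h.2 0 φ hφ hmem] at key
  simp only [ZeroMemClass.coe_zero, zero_add, LinearPMap.map_zero, zero_sub, inner_neg_right]
    at key
  rw [key, add_neg_cancel]

end IsExtAM

theorem statement5
    {H : Type*} [NormedAddCommGroup H] [InnerProductSpace ℂ H] [CompleteSpace H]
    (A : H →ₗ.[ℂ] H) (hA : Dense (A.domain : Set H)) (hAclosed : A.IsClosed)
    (M : Submodule ℂ A.adjoint.domain)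
    (hker : ∀ φ : A.adjoint.domain, φ ∈ M → A.adjoint φ = 0 → φ = 0)
    (hran : ∀ φ : A.adjoint.domain, φ ∈ M →
      A.adjoint φ ∈ A.domain → A.adjoint φ = 0)
    (Am C : H →ₗ.[ℂ] H)
    (hAm : IsExtAM A M Am)
    (hC : IsCM A M C) :
    Am.adjoint = C := by
  have hdense := hAm.dense_domain hA
  have hle := hAm.adjoint_le_adjoint hA
  refine le_antisymm ?_ ?_
  · have hdom : Am.adjoint.domain ≤ C.domain := fun x hx =>
      (hC.2 x).2 ⟨hle.1 hx, fun φ hφ => by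
        rw [← hle.2 (x := ⟨x, hx⟩) (y := ⟨x, hle.1 hx⟩) rfl]
        exact hAm.inner_add_inner_adjoint_eq_zero hA ⟨x, hx⟩ hφ⟩
    refine ⟨hdom, fun x y hxy => ?_⟩
    rw [hle.2 (y := ⟨x, hle.1 x.2⟩) rfl, hC.1.2 (y := ⟨x, hle.1 x.2⟩) hxy.symm]
  · refine LinearPMap.IsFormalAdjoint.le_adjoint hdense (LinearPMap.IsFormalAdjoint.symm ?_)
    intro x y
    obtain ⟨hx, horth⟩ := (hC.2 x).1 x.2
    obtain ⟨f, φ, hφ, hy, hAmy⟩ := hAm.exists_eq_add y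
    rw [hC.1.2 (y := ⟨x, hx⟩) rfl, hy, hAmy, inner_add_right, inner_sub_right,
      LinearPMap.adjoint_isFormalAdjoint hA ⟨x, hx⟩ f, sub_eq_add_neg,
      eq_neg_of_add_eq_zero_right (horth φ hφ)]
end

section
/- (Theorem 2.9) Let A be a densely defined closed operator on a complex Hilbert space H with adjoint A*, and let M ⊂ D(A*) be a linear subspace. Let C_M be the restriction of A* to the domain {f ∈ D(A*) : ⟨f, φ⟩ + ⟨A*f, A*φ⟩ = 0 for all φ ∈ M}. Then C_M is a closed operator. Moreover, C_M is densely defined if and only if ker(A*) ∩ cl(M) = {0} and {A*φ : φ ∈ cl(M)} ∩ D(A) = {0}, where cl(M) is the closure of M in D(A*) with respect to the graph norm of A*. -/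
/- STATEMENT 7 (Theorem 2.9): For any subspace `M ⊆ D(A*)`, the operator `C_M`
(restriction of `A*` to `{f ∈ D(A*) : ⟪f, φ⟫ + ⟪A*f, A*φ⟫ = 0 ∀ φ ∈ M}`) is closed;
it is densely defined iff `ker A* ∩ cl(M) = {0}` and `{A*φ : φ ∈ cl(M)} ∩ D(A) = {0}`,
where `cl(M)` is the closure of `M` in `D(A*)` w.r.t. the graph norm of `A*`. -/

open scoped ComplexInnerProductSpace

/-- The closure of `M` in `D(A*)` with respect to the graph norm of `A*`. -/
def graphNormClosure {H : Type*} [NormedAddCommGroup H] [InnerProductSpace ℂ H]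
    [CompleteSpace H] (A : H →ₗ.[ℂ] H) (M : Submodule ℂ A.adjoint.domain) :
    Set A.adjoint.domain :=
  {φ : A.adjoint.domain | ((φ : H), A.adjoint φ) ∈
    closure ((fun ψ : A.adjoint.domain => ((ψ : H), A.adjoint ψ)) '' M)}

theorem eq_zero_and_eq_zero_of_inner_self_add {𝕜 E F : Type*} [RCLike 𝕜]
    [NormedAddCommGroup E] [InnerProductSpace 𝕜 E]
    [NormedAddCommGroup F] [InnerProductSpace 𝕜 F] {x : E} {y : F}
    (h : inner 𝕜 x x + inner 𝕜 y y = 0) : x = 0 ∧ y = 0 := by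
  have hnorm : ‖x‖ ^ 2 + ‖y‖ ^ 2 = 0 := by
    simp only [inner_self_eq_norm_sq_to_K] at h
    exact_mod_cast h
  simpa using (add_eq_zero_iff_of_nonneg (sq_nonneg _) (sq_nonneg _)).1 hnorm

/-- Orthogonal projection onto a closed subspace of `E × F`, with the Hilbert sum inner product. -/
theorem Submodule.exists_mem_forall_inner_add_inner_eq_zero {𝕜 E F : Type*} [RCLike 𝕜]
    [NormedAddCommGroup E] [InnerProductSpace 𝕜 E] [CompleteSpace E]
    [NormedAddCommGroup F] [InnerProductSpace 𝕜 F] [CompleteSpace F]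
    (G : Submodule 𝕜 (E × F)) (hG : IsClosed (G : Set (E × F))) (x : E × F) :
    ∃ p ∈ G, ∀ q ∈ G, inner 𝕜 q.1 (x.1 - p.1) + inner 𝕜 q.2 (x.2 - p.2) = 0 := by
  let e := WithLp.prodContinuousLinearEquiv 2 𝕜 E F
  let K : Submodule 𝕜 (WithLp 2 (E × F)) := G.comap e.toLinearEquiv.toLinearMap
  have hK : IsClosed (K : Set (WithLp 2 (E × F))) := hG.preimage e.continuous
  have : CompleteSpace K := hK.completeSpace_coe
  refine ⟨e (K.starProjection (WithLp.toLp 2 x)), K.starProjection_apply_mem _, fun q hq => ?_⟩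
  have h := K.sub_starProjection_mem_orthogonal (WithLp.toLp 2 x)
  exact (K.mem_orthogonal _).1 h (WithLp.toLp 2 q) hq

namespace LinearPMap

/-- A closed densely defined operator contains the adjoint of its adjoint. -/
theorem mem_graph_of_forall_inner_adjoint {𝕜 E F : Type*} [RCLike 𝕜]
    [NormedAddCommGroup E] [InnerProductSpace 𝕜 E] [CompleteSpace E]
    [NormedAddCommGroup F] [InnerProductSpace 𝕜 F] [CompleteSpace F]
    {T : E →ₗ.[𝕜] F} (hT : Dense (T.domain : Set E)) (hTc : T.IsClosed) {x : E} {y : F}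
    (h : ∀ f : T.adjoint.domain, inner 𝕜 (f : F) y = inner 𝕜 (T.adjoint f) x) :
    (x, y) ∈ T.graph := by
  obtain ⟨p, hp, hpq⟩ := T.graph.exists_mem_forall_inner_add_inner_eq_zero hTc (x, y)
  have hw : ∀ a : T.domain, inner 𝕜 (-(x - p.1)) (a : E) = inner 𝕜 (y - p.2) (T a) := by
    intro a
    have h1 := congrArg (starRingEnd 𝕜) (hpq _ (T.mem_graph a))
    simp only [_root_.map_add, inner_conj_symm, _root_.map_zero] at h1
    rw [inner_neg_left]
    linear_combination -h1
  have hmem := T.mem_adjoint_domain_of_exists (y - p.2) ⟨_, hw⟩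
  have hval := adjoint_apply_eq hT ⟨y - p.2, hmem⟩ hw
  have h1 := h ⟨y - p.2, hmem⟩
  obtain ⟨a, ha⟩ := (T.mem_graph_iff).1 hp
  have h2 := hw a
  rw [hval] at h1
  rw [ha.1, ha.2] at h2
  have h3 : inner 𝕜 (y - p.2) (y - p.2) + inner 𝕜 (x - p.1) (x - p.1) = 0 := by
    rw [inner_sub_right (y - p.2), inner_sub_right (x - p.1)]
    simp only [inner_neg_left] at h1 h2
    linear_combination h1 + h2
  obtain ⟨hy, hx⟩ := eq_zero_and_eq_zero_of_inner_self_add h3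
  rw [sub_eq_zero] at hx hy
  rw [hx, hy]
  exact hp

end LinearPMap

section

variable {H : Type*} [NormedAddCommGroup H] [InnerProductSpace ℂ H] [CompleteSpace H]
  {A C : H →ₗ.[ℂ] H} {M : Submodule ℂ A.adjoint.domain}

theorem IsCM.mem_graph_iff (hC : IsCM A M C) (z : H × H) :
    z ∈ C.graph ↔ z ∈ A.adjoint.graph ∧
      ∀ φ : A.adjoint.domain, φ ∈ M → ⟪z.1, (φ : H)⟫ + ⟪z.2, A.adjoint φ⟫ = 0 := by
  constructor
  · intro hz
    refine ⟨LinearPMap.le_graph_of_le hC.1 hz, fun φ hφ => ?_⟩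
    obtain ⟨c, hc⟩ := C.mem_graph_iff.1 hz
    obtain ⟨hx, h⟩ := (hC.2 c).1 c.2
    have h1 : C c = A.adjoint ⟨c, hx⟩ := hC.1.2 rfl
    rw [← hc.1, ← hc.2, h1]
    exact h φ hφ
  · rintro ⟨hz, h⟩
    obtain ⟨a, ha⟩ := A.adjoint.mem_graph_iff.1 hz
    have hmem : (a : H) ∈ C.domain := (hC.2 a).2 ⟨a.2, fun φ hφ => by
      have := h φ hφ
      rwa [← ha.1, ← ha.2] at this⟩
    refine C.mem_graph_iff.2 ⟨⟨a, hmem⟩, ha.1, ?_⟩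
    rw [← ha.2]
    exact hC.1.2 rfl

theorem IsCM.isClosed (hA : Dense (A.domain : Set H)) (hC : IsCM A M C) : C.IsClosed := by
  have h : (C.graph : Set (H × H)) = (A.adjoint.graph : Set (H × H)) ∩
      ⋂ φ ∈ M, {z : H × H | ⟪z.1, (φ : H)⟫ + ⟪z.2, A.adjoint φ⟫ = 0} := by
    ext z
    simpa using hC.mem_graph_iff z
  unfold LinearPMap.IsClosed
  rw [h]
  refine IsClosed.inter (A.adjoint_isClosed hA) (isClosed_biInter fun φ _ => ?_)
  exact isClosed_eq (by fun_prop) continuous_const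

theorem IsCM.inner_add_inner_eq_zero (hC : IsCM A M C) {z : H × H} (hz : z ∈ C.graph)
    {p : H × H}
    (hp : p ∈ closure ((fun ψ : A.adjoint.domain => ((ψ : H), A.adjoint ψ)) '' M)) :
    ⟪z.1, p.1⟫ + ⟪z.2, p.2⟫ = 0 := by
  have hcl : IsClosed {p : H × H | ⟪z.1, p.1⟫ + ⟪z.2, p.2⟫ = 0} :=
    isClosed_eq (by fun_prop) continuous_const
  refine closure_minimal ?_ hcl hp
  rintro _ ⟨φ, hφ, rfl⟩
  exact ((hC.mem_graph_iff z).1 hz).2 φ hφ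

/-- Every vector orthogonal to `D(C_M)` has the form `φ + A A* φ` with `φ ∈ cl(M)`. -/
theorem IsCM.exists_of_orthogonal_domain (hA : Dense (A.domain : Set H)) (hAc : A.IsClosed)
    (hC : IsCM A M C) {ψ : H} (hψ : ∀ f ∈ C.domain, ⟪f, ψ⟫ = 0) :
    ∃ φ ∈ graphNormClosure A M, (A.adjoint φ, ψ - φ) ∈ A.graph := by
  have hAs : IsClosed (A.adjoint.graph : Set (H × H)) := A.adjoint_isClosed hA
  let N : Submodule ℂ (H × H) :=
    (M.map (A.adjoint.domain.subtype.prod A.adjoint.toFun)).topologicalClosure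
  have hNΓ : N ≤ A.adjoint.graph := by
    refine Submodule.topologicalClosure_minimal _ ?_ hAs
    rintro _ ⟨φ, -, rfl⟩
    exact A.adjoint.mem_graph φ
  obtain ⟨p, hp, hpN⟩ := N.exists_mem_forall_inner_add_inner_eq_zero
    (Submodule.isClosed_topologicalClosure _) (ψ, 0)
  obtain ⟨q, hq, hqΓ⟩ := A.adjoint.graph.exists_mem_forall_inner_add_inner_eq_zero hAs
    (ψ - p.1, 0 - p.2)
  have hqC : q ∈ C.graph := by
    refine (hC.mem_graph_iff q).2 ⟨hq, fun φ hφ => ?_⟩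
    have hφN : ((φ : H), A.adjoint φ) ∈ N := subset_closure ⟨φ, hφ, rfl⟩
    have h1 := hpN _ hφN
    have h2 := hqΓ _ (hNΓ hφN)
    simp only [inner_sub_right _ _ q.1, inner_sub_right _ _ q.2] at h2
    have h3 : ⟪(φ : H), q.1⟫ + ⟪A.adjoint φ, q.2⟫ = 0 := by linear_combination h1 - h2
    simpa only [map_add, inner_conj_symm, map_zero] using congrArg (starRingEnd ℂ) h3
  have hq0 : ⟪q.1, q.1⟫ + ⟪q.2, q.2⟫ = 0 := by
    have h1 := hqΓ q hq
    have h2 := hC.inner_add_inner_eq_zero hqC (p := p) hp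
    have h3 := hψ q.1 (LinearPMap.mem_domain_of_mem_graph hqC)
    simp only [inner_sub_right, inner_zero_right] at h1
    linear_combination h3 - h2 - h1
  obtain ⟨hq1, hq2⟩ := eq_zero_and_eq_zero_of_inner_self_add hq0
  obtain ⟨φ, hφ⟩ := A.adjoint.mem_graph_iff.1 (hNΓ hp)
  have hpφ : ((φ : H), A.adjoint φ) = p := Prod.ext hφ.1 hφ.2
  refine ⟨φ, ?_, LinearPMap.mem_graph_of_forall_inner_adjoint hA hAc fun f => ?_⟩
  · change ((φ : H), A.adjoint φ) ∈ (N : Set (H × H))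
    rwa [hpφ]
  · have h := hqΓ _ (A.adjoint.mem_graph f)
    rw [hq1, hq2, ← hφ.1, ← hφ.2] at h
    simp only [sub_zero, zero_sub, inner_neg_right] at h
    linear_combination h

end

theorem statement7
    {H : Type*} [NormedAddCommGroup H] [InnerProductSpace ℂ H] [CompleteSpace H]
    (A : H →ₗ.[ℂ] H) (hA : Dense (A.domain : Set H)) (hAclosed : A.IsClosed)
    (M : Submodule ℂ A.adjoint.domain)
    (C : H →ₗ.[ℂ] H) (hC : IsCM A M C) :
    C.IsClosed ∧
    (Dense (C.domain : Set H) ↔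
      ((∀ φ : A.adjoint.domain, φ ∈ graphNormClosure A M → A.adjoint φ = 0 → φ = 0) ∧
       (∀ φ : A.adjoint.domain, φ ∈ graphNormClosure A M →
          A.adjoint φ ∈ A.domain → A.adjoint φ = 0))) := by
  refine ⟨hC.isClosed hA, fun hd => ?_, fun ⟨hker, hran⟩ => ?_⟩
  · have key : ∀ φ : A.adjoint.domain, φ ∈ graphNormClosure A M →
        A.adjoint φ ∈ A.domain → φ = 0 := by
      intro φ hφ hmem
      have hadj (f : A.adjoint.domain) :
          ⟪A.adjoint f, A.adjoint φ⟫ = ⟪(f : H), A ⟨A.adjoint φ, hmem⟩⟫ :=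
        A.adjoint_isFormalAdjoint hA f ⟨A.adjoint φ, hmem⟩
      have hψ : (φ : H) + A ⟨A.adjoint φ, hmem⟩ = 0 := by
        refine hd.eq_zero_of_inner_right ℂ fun f hf => ?_
        obtain ⟨hx, -⟩ := (hC.2 f).1 hf
        have h := hC.inner_add_inner_eq_zero (C.mem_graph ⟨f, hf⟩) hφ
        have hval : C ⟨f, hf⟩ = A.adjoint ⟨f, hx⟩ := hC.1.2 rfl
        simp only [hval, hadj] at h
        rw [inner_add_right]
        exact h
      have h : ⟪(φ : H), (φ : H)⟫ + ⟪A.adjoint φ, A.adjoint φ⟫ = 0 := by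
        rw [hadj, ← inner_add_right, hψ, inner_zero_right]
      exact Subtype.ext (eq_zero_and_eq_zero_of_inner_self_add h).1
    refine ⟨fun φ hφ h0 => key φ hφ (h0 ▸ A.domain.zero_mem), fun φ hφ hmem => ?_⟩
    rw [key φ hφ hmem, LinearPMap.map_zero]
  · rw [Submodule.dense_iff_topologicalClosure_eq_top,
      Submodule.topologicalClosure_eq_top_iff, Submodule.eq_bot_iff]
    intro ψ hψ
    obtain ⟨φ, hφ, hg⟩ := hC.exists_of_orthogonal_domain hA hAclosed
      fun f hf => (Submodule.mem_orthogonal _ _).1 hψ f hf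
    have h0 := hran φ hφ (LinearPMap.mem_domain_of_mem_graph hg)
    have hφ0 := hker φ hφ h0
    have := A.graph_fst_eq_zero_snd hg h0
    simpa [hφ0] using this
end

section
/- (Corollary 2.10) Let A be a densely defined closed operator on a complex Hilbert space H with adjoint A*. Let M ⊂ D(A*) be a linear subspace satisfying ker(A*) ∩ M = {0} and {A*φ : φ ∈ M} ∩ D(A) = {0}, but for which it fails that both ker(A*) ∩ cl(M) = {0} and {A*φ : φ ∈ cl(M)} ∩ D(A) = {0} hold, where cl(M) is the closure of M with respect to the graph norm of A*. Then the operator A_M, with domain D(A) ∔ {A*φ : φ ∈ M} acting by f + A*φ ↦ Af − φ, is not closable. -/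
section

variable {H : Type*} [NormedAddCommGroup H] [InnerProductSpace ℂ H] [CompleteSpace H]
  {A B : H →ₗ.[ℂ] H} {M : Submodule ℂ A.adjoint.domain}

theorem IsExtAM.mem_graph (hB : IsExtAM A M B) (f : A.domain) {φ : A.adjoint.domain}
    (hφ : φ ∈ M) : ((f : H) + A.adjoint φ, A f - (φ : H)) ∈ B.graph := by
  have hmem : (f : H) + A.adjoint φ ∈ B.domain := by
    rw [hB.1]
    exact Submodule.add_mem_sup f.2 (Submodule.mem_map_of_mem hφ)
  rw [← hB.2 f φ hφ hmem]
  exact B.mem_graph ⟨_, hmem⟩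

theorem IsExtAM.graph_le (hB : IsExtAM A M B) : A.graph ≤ B.graph := by
  intro x hx
  obtain ⟨f, rfl⟩ := (A.mem_graph_iff').1 hx
  simpa using hB.mem_graph f M.zero_mem

theorem IsExtAM.adjoint_neg_mem_closure_graph (hB : IsExtAM A M B) {φ : A.adjoint.domain}
    (hφ : φ ∈ graphNormClosure A M) :
    (A.adjoint φ, -(φ : H)) ∈ B.graph.topologicalClosure := by
  refine map_mem_closure (f := fun p : H × H => (p.2, -p.1)) (by fun_prop) hφ ?_
  rintro _ ⟨ψ, hψ, rfl⟩
  simpa using hB.mem_graph 0 hψ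

/-- If `A*φ ∈ D(A)` and `A A*φ = -φ`, then `‖A*φ‖² = -‖φ‖²`, so `A*φ = 0`. -/
theorem adjoint_apply_eq_zero_of_mem_graph_neg (hA : Dense (A.domain : Set H))
    {φ : A.adjoint.domain} (h : (A.adjoint φ, -(φ : H)) ∈ A.graph) : A.adjoint φ = 0 := by
  obtain ⟨y, hy, hAy⟩ := A.mem_graph_iff.1 h
  have key := LinearPMap.adjoint_isFormalAdjoint hA φ y
  simp only [hy, hAy, inner_neg_right, inner_self_eq_norm_sq_to_K] at key
  have key' : ‖A.adjoint φ‖ ^ 2 = -‖(φ : H)‖ ^ 2 := by exact_mod_cast key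
  have : ‖A.adjoint φ‖ ^ 2 = 0 := by nlinarith [sq_nonneg ‖A.adjoint φ‖, sq_nonneg ‖(φ : H)‖]
  simpa using this

end

theorem statement8
    {H : Type*} [NormedAddCommGroup H] [InnerProductSpace ℂ H] [CompleteSpace H]
    (A : H →ₗ.[ℂ] H) (hA : Dense (A.domain : Set H)) (hAclosed : A.IsClosed)
    (M : Submodule ℂ A.adjoint.domain)
    (hker : ∀ φ : A.adjoint.domain, φ ∈ M → A.adjoint φ = 0 → φ = 0)
    (hran : ∀ φ : A.adjoint.domain, φ ∈ M →
      A.adjoint φ ∈ A.domain → A.adjoint φ = 0)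
    (hfail : ¬ ((∀ φ : A.adjoint.domain, φ ∈ graphNormClosure A M →
        A.adjoint φ = 0 → φ = 0) ∧
      (∀ φ : A.adjoint.domain, φ ∈ graphNormClosure A M →
        A.adjoint φ ∈ A.domain → A.adjoint φ = 0)))
    (B : H →ₗ.[ℂ] H) (hB : IsExtAM A M B) :
    ¬ B.IsClosable := by
  rintro ⟨C, hC⟩
  have hmem : ∀ φ ∈ graphNormClosure A M, (A.adjoint φ, -(φ : H)) ∈ C.graph := fun φ hφ =>
    hC ▸ hB.adjoint_neg_mem_closure_graph hφ
  have hAC : A.graph ≤ C.graph := hC ▸ hB.graph_le.trans B.graph.le_topologicalClosure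
  refine hfail ⟨fun φ hφ h0 => ?_, fun φ hφ hdom => ?_⟩
  · simpa using C.graph_fst_eq_zero_snd (hmem φ hφ) h0
  · have hgraph := A.mem_graph ⟨A.adjoint φ, hdom⟩
    rw [C.mem_graph_snd_inj (hAC hgraph) (hmem φ hφ) rfl] at hgraph
    exact adjoint_apply_eq_zero_of_mem_graph_neg hA hgraph
end

section
/- (Theorem 2.12, surjectivity) Let A be a densely defined closed operator on a complex Hilbert space H with adjoint A*. Then for every closed operator B on H extending A, there exists a linear subspace M ⊂ D(A*) that is closed with respect to the graph norm of A* and satisfies ker(A*) ∩ M = {0} and {A*φ : φ ∈ M} ∩ D(A) = {0}, such that B = A_M, where A_M is the operator with domain D(A) ∔ {A*φ : φ ∈ M} acting by f + A*φ ↦ Af − φ. -/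
/-- Orthogonal decomposition of a pair along the closed graph of a densely defined operator:
the orthogonal complement of the graph of `A` is `{(A*φ, -φ) : φ ∈ D(A*)}`. -/
theorem LinearPMap.IsClosed.exists_graph_add_adjoint
    {H : Type*} [NormedAddCommGroup H] [InnerProductSpace ℂ H] [CompleteSpace H]
    {A : H →ₗ.[ℂ] H} (hAclosed : A.IsClosed) (hA : Dense (A.domain : Set H)) (x y : H) :
    ∃ (f : A.domain) (φ : A.adjoint.domain),
      x = f + A.adjoint φ ∧ y = A f - (φ : H) := by
  let G : Submodule ℂ (WithLp 2 (H × H)) :=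
    A.graph.comap (WithLp.linearEquiv 2 ℂ (H × H)).toLinearMap
  have hG : _root_.IsClosed (G : Set (WithLp 2 (H × H))) :=
    _root_.IsClosed.preimage (WithLp.prod_continuous_ofLp 2 H H) hAclosed
  have : CompleteSpace G := hG.completeSpace_coe
  obtain ⟨p, hp, q, hq, hpq⟩ := G.exists_add_mem_mem_orthogonal (WithLp.toLp 2 (x, y))
  obtain ⟨f, hf1, hf2⟩ := (LinearPMap.mem_graph_iff A).1 hp
  have key (g : A.domain) : inner ℂ q.fst (g : H) = inner ℂ (-q.snd) (A g) := by
    have hg : WithLp.toLp 2 ((g : H), A g) ∈ G := A.mem_graph g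
    have h := (G.mem_orthogonal' q).1 hq _ hg
    rw [WithLp.prod_inner_apply] at h
    rw [inner_neg_left]
    exact eq_neg_of_add_eq_zero_left h
  let φ : A.adjoint.domain :=
    ⟨-q.snd, A.mem_adjoint_domain_of_exists _ ⟨q.fst, key⟩⟩
  have hφ : A.adjoint φ = q.fst := LinearPMap.adjoint_apply_eq hA φ key
  refine ⟨f, φ, ?_, ?_⟩
  · rw [hφ, hf1]
    exact congrArg WithLp.fst hpq
  · rw [hf2, sub_neg_eq_add]
    exact congrArg WithLp.snd hpq

theorem statement9
    {H : Type*} [NormedAddCommGroup H] [InnerProductSpace ℂ H] [CompleteSpace H]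
    (A : H →ₗ.[ℂ] H) (hA : Dense (A.domain : Set H)) (hAclosed : A.IsClosed)
    (B : H →ₗ.[ℂ] H) (hBclosed : B.IsClosed) (hAB : A ≤ B) :
    ∃ M : Submodule ℂ A.adjoint.domain,
      graphNormClosure A M ⊆ (M : Set A.adjoint.domain) ∧
      (∀ φ : A.adjoint.domain, φ ∈ M → A.adjoint φ = 0 → φ = 0) ∧
      (∀ φ : A.adjoint.domain, φ ∈ M → A.adjoint φ ∈ A.domain → A.adjoint φ = 0) ∧
      IsExtAM A M B := by
  have hgraph : A.graph ≤ B.graph := LinearPMap.le_graph_of_le hAB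
  let M : Submodule ℂ A.adjoint.domain :=
    B.graph.comap (A.adjoint.toFun.prod (-A.adjoint.domain.subtype))
  have hM (φ : A.adjoint.domain) : φ ∈ M ↔ (A.adjoint φ, -(φ : H)) ∈ B.graph := Iff.rfl
  refine ⟨M, ?_, ?_, ?_, ?_, ?_⟩
  · intro φ hφ
    have hS : IsClosed {p : H × H | (p.2, -p.1) ∈ B.graph} :=
      IsClosed.preimage (f := fun p : H × H => (p.2, -p.1)) (by fun_prop) hBclosed
    exact closure_minimal (by rintro _ ⟨ψ, hψ, rfl⟩; exact hψ) hS hφ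
  · intro φ hφ h0
    have h := B.graph_fst_eq_zero_snd ((hM φ).1 hφ) h0
    exact Subtype.ext (neg_eq_zero.1 h)
  · intro φ hφ hmem
    have h1 : (A.adjoint φ, A ⟨_, hmem⟩) ∈ B.graph := hgraph (A.mem_graph ⟨_, hmem⟩)
    have h2 : A ⟨_, hmem⟩ = -(φ : H) := B.mem_graph_snd_inj h1 ((hM φ).1 hφ) rfl
    have h3 := A.adjoint_isFormalAdjoint hA φ ⟨_, hmem⟩
    rw [h2, inner_neg_right, inner_self_eq_norm_sq_to_K, inner_self_eq_norm_sq_to_K] at h3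
    have h4 : ‖A.adjoint φ‖ ^ 2 = -‖(φ : H)‖ ^ 2 := by exact_mod_cast h3
    have h5 : ‖A.adjoint φ‖ ^ 2 = 0 := by
      linarith [sq_nonneg ‖A.adjoint φ‖, sq_nonneg ‖(φ : H)‖]
    simpa using h5
  · apply le_antisymm
    · intro g hg
      obtain ⟨f, φ, hx, hy⟩ := hAclosed.exists_graph_add_adjoint hA g (B ⟨g, hg⟩)
      have hφ : φ ∈ M := by
        rw [hM]
        have h := B.graph.sub_mem (B.mem_graph ⟨g, hg⟩) (hgraph (A.mem_graph f))
        rw [hy] at h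
        simpa [hx] using h
      rw [hx]
      exact Submodule.add_mem_sup f.2 (Submodule.mem_map_of_mem hφ)
    · refine sup_le hAB.1 ?_
      rintro _ ⟨φ, hφ, rfl⟩
      exact B.mem_domain_of_mem_graph ((hM φ).1 hφ)
  · intro f φ hφ hmem
    have h := B.graph.add_mem (hgraph (A.mem_graph f)) ((hM φ).1 hφ)
    rw [Prod.mk_add_mk, ← sub_eq_add_neg] at h
    exact B.mem_graph_snd_inj (B.mem_graph ⟨_, hmem⟩) h rfl
end

section
/- (Theorem 2.12, injectivity) Let A be a densely defined closed operator on a complex Hilbert space H with adjoint A*. Suppose M and M' are linear subspaces of D(A*), each closed with respect to the graph norm of A*, each satisfying ker(A*) ∩ M = {0}, {A*φ : φ ∈ M} ∩ D(A) = {0} (and likewise for M'). If A_M = A_{M'} (equality of operators, i.e. equal domains and equal action), then M = M'. -/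
/-- If `A* η = -f` and `A f = η`, then `‖η‖² = ⟪f, A* η⟫ = -‖A* η‖²`, so `η = 0`. -/
theorem adjoint_domain_eq_zero_of_apply_eq {H : Type*} [NormedAddCommGroup H]
    [InnerProductSpace ℂ H] [CompleteSpace H] {A : H →ₗ.[ℂ] H}
    (hA : Dense (A.domain : Set H)) (f : A.domain) (η : A.adjoint.domain)
    (hf : A.adjoint η = -(f : H)) (hη : A f = (η : H)) : η = 0 := by
  have h := LinearPMap.adjoint_isFormalAdjoint hA η f
  rw [hf, hη, inner_neg_left, inner_self_eq_norm_sq_to_K, inner_self_eq_norm_sq_to_K] at h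
  have h' : -‖(f : H)‖ ^ 2 = ‖(η : H)‖ ^ 2 := by exact_mod_cast h
  have : ‖(η : H)‖ = 0 := by nlinarith [sq_nonneg ‖(f : H)‖, sq_nonneg ‖(η : H)‖]
  exact Subtype.ext (norm_eq_zero.mp this)

/-- If `A_M` and `A_{M'}` agree, then `M ≤ M'`. -/
theorem IsExtAM.le_s10 {H : Type*} [NormedAddCommGroup H] [InnerProductSpace ℂ H]
    [CompleteSpace H] {A B : H →ₗ.[ℂ] H} (hA : Dense (A.domain : Set H))
    {M M' : Submodule ℂ A.adjoint.domain} (hM : IsExtAM A M B) (hM' : IsExtAM A M' B) :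
    M ≤ M' := by
  intro φ hφ
  have hmem : ((0 : A.domain) : H) + A.adjoint φ ∈ B.domain := by
    rw [hM.1]
    exact Submodule.add_mem_sup (0 : A.domain).2 (Submodule.mem_map_of_mem hφ)
  have hmem' := hmem
  rw [hM'.1, Submodule.mem_sup] at hmem'
  obtain ⟨f, hf, _, ⟨φ', hφ', rfl⟩, heq⟩ := hmem'
  replace heq : f + A.adjoint φ' = ((0 : A.domain) : H) + A.adjoint φ := heq
  have hB := hM.2 0 φ hφ hmem
  have hB' := hM'.2 ⟨f, hf⟩ φ' hφ' (heq ▸ hmem)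
  have hBB : A ⟨f, hf⟩ - (φ' : H) = A 0 - (φ : H) := by
    rw [← hB, ← hB']
    congr 2
  rw [LinearPMap.map_zero, zero_sub] at hBB
  rw [ZeroMemClass.coe_zero, zero_add] at heq
  have h0 : φ' - φ = 0 := by
    refine adjoint_domain_eq_zero_of_apply_eq hA ⟨f, hf⟩ (φ' - φ) ?_ ?_
    · rw [LinearPMap.map_sub, ← heq]
      abel
    · rw [Submodule.coe_sub, ← sub_eq_zero, sub_eq_add_neg, neg_sub, add_sub_left_comm,
        hBB]
      abel
  rwa [← sub_eq_zero.mp h0]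

theorem statement10
    {H : Type*} [NormedAddCommGroup H] [InnerProductSpace ℂ H] [CompleteSpace H]
    (A : H →ₗ.[ℂ] H) (hA : Dense (A.domain : Set H)) (hAclosed : A.IsClosed)
    (M M' : Submodule ℂ A.adjoint.domain)
    (hMc : graphNormClosure A M ⊆ (M : Set A.adjoint.domain))
    (hM'c : graphNormClosure A M' ⊆ (M' : Set A.adjoint.domain))
    (hker : ∀ φ : A.adjoint.domain, φ ∈ M → A.adjoint φ = 0 → φ = 0)
    (hran : ∀ φ : A.adjoint.domain, φ ∈ M → A.adjoint φ ∈ A.domain → A.adjoint φ = 0)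
    (hker' : ∀ φ : A.adjoint.domain, φ ∈ M' → A.adjoint φ = 0 → φ = 0)
    (hran' : ∀ φ : A.adjoint.domain, φ ∈ M' → A.adjoint φ ∈ A.domain → A.adjoint φ = 0)
    (B : H →ₗ.[ℂ] H) (hBM : IsExtAM A M B) (hBM' : IsExtAM A M' B) :
    M = M' := by
  exact le_antisymm (hBM.le_s10 hA hBM') (hBM'.le_s10 hA hBM)
end

section
/- (Corollary 2.13) Let A be a densely defined closable operator on a complex Hilbert space H with densely defined adjoint A*. Then for every densely defined closed operator C that is a restriction of A*, there exists a unique linear subspace M ⊂ D(A*), closed with respect to the graph norm of A* and satisfying ker(A*) ∩ M = {0} and {A*φ : φ ∈ M} ∩ D(A) = {0}, such that C = C_M, where C_M is the restriction of A* to the domain {f ∈ D(A*) : ⟨f, φ⟩ + ⟨A*f, A*φ⟩ = 0 for all φ ∈ M}. -/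
/- STATEMENT 11 (Corollary 2.13): Let `A` be densely defined and closable (so `A*` is
densely defined). Every densely defined closed restriction `C` of `A*` equals `C_M`
for a unique subspace `M ⊆ D(A*)` that is closed w.r.t. the graph norm of `A*` and
satisfies `ker A* ∩ M = {0}` and `{A*φ : φ ∈ M} ∩ D(A) = {0}`. -/

open scoped ComplexInnerProductSpace

open WithLp in
/-- Orthogonal projection onto a closed subspace of `E × F` with respect to the `L²` inner product
`⟪x.1, y.1⟫ + ⟪x.2, y.2⟫`. -/
theorem exists_mem_forall_inner_fst_add_inner_snd_eq_zero {𝕜 E F : Type*} [RCLike 𝕜]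
    [NormedAddCommGroup E] [InnerProductSpace 𝕜 E] [CompleteSpace E]
    [NormedAddCommGroup F] [InnerProductSpace 𝕜 F] [CompleteSpace F]
    {G : Submodule 𝕜 (E × F)} (hG : IsClosed (G : Set (E × F))) (x : E × F) :
    ∃ y ∈ G, ∀ z ∈ G, inner 𝕜 z.1 (x - y).1 + inner 𝕜 z.2 (x - y).2 = 0 := by
  let G' : Submodule 𝕜 (WithLp 2 (E × F)) := G.comap (WithLp.linearEquiv 2 𝕜 (E × F)).toLinearMap
  have hG' : IsClosed (G' : Set (WithLp 2 (E × F))) :=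
    hG.preimage (WithLp.prod_continuous_ofLp 2 E F)
  have : CompleteSpace G' := hG'.completeSpace_coe
  refine ⟨ofLp (G'.starProjection (toLp 2 x)), G'.starProjection_apply_mem _, fun z hz => ?_⟩
  have h := G'.sub_starProjection_mem_orthogonal (toLp 2 x) (toLp 2 z) hz
  simpa only [prod_inner_apply, ofLp_sub] using h

namespace LinearPMap

variable {H : Type*} [NormedAddCommGroup H] [InnerProductSpace ℂ H] [CompleteSpace H]

/-- The inner product of the graph space of `A*`. -/
noncomputable def adjointGraphInner (A : H →ₗ.[ℂ] H) (f φ : A.adjoint.domain) : ℂ :=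
  ⟪(f : H), (φ : H)⟫ + ⟪A.adjoint f, A.adjoint φ⟫

variable {A : H →ₗ.[ℂ] H}

theorem adjointGraphInner_add_right (f φ ψ : A.adjoint.domain) :
    A.adjointGraphInner f (φ + ψ) = A.adjointGraphInner f φ + A.adjointGraphInner f ψ := by
  simp only [adjointGraphInner, map_add, Submodule.coe_add, inner_add_right]
  ring

theorem adjointGraphInner_sub_right (f φ ψ : A.adjoint.domain) :
    A.adjointGraphInner f (φ - ψ) = A.adjointGraphInner f φ - A.adjointGraphInner f ψ := by
  simp only [adjointGraphInner, map_sub, AddSubgroupClass.coe_sub, inner_sub_right]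
  ring

theorem adjointGraphInner_smul_right (c : ℂ) (f φ : A.adjoint.domain) :
    A.adjointGraphInner f (c • φ) = c * A.adjointGraphInner f φ := by
  simp only [adjointGraphInner, map_smul, Submodule.coe_smul, inner_smul_right]
  ring

theorem adjointGraphInner_eq_zero_symm {f φ : A.adjoint.domain}
    (h : A.adjointGraphInner f φ = 0) : A.adjointGraphInner φ f = 0 := by
  have h' := congrArg (starRingEnd ℂ) h
  simpa only [adjointGraphInner, _root_.map_add, inner_conj_symm, _root_.map_zero] using h'

theorem eq_zero_of_adjointGraphInner_self {φ : A.adjoint.domain}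
    (h : A.adjointGraphInner φ φ = 0) : φ = 0 := by
  have h' : ‖(φ : H)‖ ^ 2 + ‖A.adjoint φ‖ ^ 2 = 0 := by
    simp only [adjointGraphInner, inner_self_eq_norm_sq_to_K] at h
    exact (RCLike.ofReal_eq_zero (K := ℂ)).mp (by push_cast; exact h)
  have h0 : ‖(φ : H)‖ = 0 := by nlinarith [sq_nonneg ‖(φ : H)‖, sq_nonneg ‖A.adjoint φ‖]
  exact Subtype.ext (norm_eq_zero.mp h0)

/-- The image of a subspace of `D(A*)` in the graph of `A*`. -/
noncomputable def adjointGraphImage (A : H →ₗ.[ℂ] H) (M : Submodule ℂ A.adjoint.domain) :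
    Submodule ℂ (H × H) :=
  M.map (A.adjoint.domain.subtype.prod A.adjoint.toFun)

theorem mem_adjointGraphImage {M : Submodule ℂ A.adjoint.domain} {x : H × H} :
    x ∈ A.adjointGraphImage M ↔ ∃ φ ∈ M, ((φ : H), A.adjoint φ) = x :=
  Iff.rfl

theorem isClosed_adjointGraphImage (hA : Dense (A.domain : Set H))
    {M : Submodule ℂ A.adjoint.domain}
    (hM : graphNormClosure A M ⊆ (M : Set A.adjoint.domain)) :
    _root_.IsClosed (A.adjointGraphImage M : Set (H × H)) := by
  refine isClosed_of_closure_subset fun x hx => ?_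
  have hle : (A.adjointGraphImage M : Set (H × H)) ⊆ A.adjoint.graph := by
    rintro _ ⟨φ, -, rfl⟩
    exact A.adjoint.mem_graph φ
  obtain ⟨φ, h1, h2⟩ := (mem_graph_iff _).mp (closure_minimal hle (adjoint_isClosed hA) hx)
  obtain rfl : ((φ : H), A.adjoint φ) = x := Prod.ext h1 h2
  exact ⟨φ, hM hx, rfl⟩

/-- A graph-norm closed subspace of `D(A*)` admits orthogonal projections for the graph inner
product. -/
theorem exists_mem_adjointGraphInner_sub_eq_zero {M : Submodule ℂ A.adjoint.domain}
    (hM : _root_.IsClosed (A.adjointGraphImage M : Set (H × H))) (φ : A.adjoint.domain) :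
    ∃ p ∈ M, ∀ f ∈ M, A.adjointGraphInner f (φ - p) = 0 := by
  obtain ⟨_, ⟨p, hp, rfl⟩, h⟩ :=
    exists_mem_forall_inner_fst_add_inner_snd_eq_zero hM ((φ : H), A.adjoint φ)
  refine ⟨p, hp, fun f hf => ?_⟩
  rw [adjointGraphInner, map_sub]
  exact h _ ⟨f, hf, rfl⟩

/-- The orthogonal complement of a subspace of `D(A*)` for the graph inner product of `A*`. -/
noncomputable def adjointGraphOrthogonal (A : H →ₗ.[ℂ] H) (K : Submodule ℂ A.adjoint.domain) :
    Submodule ℂ A.adjoint.domain where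
  carrier := {φ | ∀ f ∈ K, A.adjointGraphInner f φ = 0}
  zero_mem' f _ := by simp [adjointGraphInner]
  add_mem' hφ hψ f hf := by rw [adjointGraphInner_add_right, hφ f hf, hψ f hf, add_zero]
  smul_mem' c φ hφ f hf := by rw [adjointGraphInner_smul_right, hφ f hf, mul_zero]

theorem graphNormClosure_adjointGraphOrthogonal_subset (K : Submodule ℂ A.adjoint.domain) :
    graphNormClosure A (A.adjointGraphOrthogonal K) ⊆
      (A.adjointGraphOrthogonal K : Set A.adjoint.domain) := by
  intro φ hφ f hf
  have hclosed : _root_.IsClosed {x : H × H | ⟪(f : H), x.1⟫ + ⟪A.adjoint f, x.2⟫ = 0} :=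
    isClosed_eq (by fun_prop) continuous_const
  refine closure_minimal ?_ hclosed hφ
  rintro _ ⟨ψ, hψ, rfl⟩
  exact hψ f hf

theorem adjointGraphOrthogonal_orthogonal {K : Submodule ℂ A.adjoint.domain}
    (hK : _root_.IsClosed (A.adjointGraphImage K : Set (H × H))) :
    A.adjointGraphOrthogonal (A.adjointGraphOrthogonal K) = K := by
  refine le_antisymm (fun φ hφ => ?_) fun φ hφ f hf => adjointGraphInner_eq_zero_symm (hf φ hφ)
  obtain ⟨p, hp, h⟩ := exists_mem_adjointGraphInner_sub_eq_zero hK φ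
  have hself : A.adjointGraphInner (φ - p) (φ - p) = 0 := by
    rw [adjointGraphInner_sub_right, hφ _ h, adjointGraphInner_eq_zero_symm (h p hp), sub_zero]
  rwa [sub_eq_zero.mp (eq_zero_of_adjointGraphInner_self hself)]

/-- For a restriction `C` of `A*`, being `C_M` says that `D(C)` is the orthogonal complement of `M`
in the graph space of `A*`. -/
theorem isCM_iff {M : Submodule ℂ A.adjoint.domain} {C : H →ₗ.[ℂ] H} (hC : C ≤ A.adjoint) :
    IsCM A M C ↔
      C.domain.comap A.adjoint.domain.subtype = A.adjointGraphOrthogonal M := by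
  constructor
  · rintro ⟨-, h⟩
    ext x
    refine (h x).trans ⟨fun ⟨_, h⟩ φ hφ => adjointGraphInner_eq_zero_symm (h φ hφ),
      fun h => ⟨x.2, fun φ hφ => adjointGraphInner_eq_zero_symm (h φ hφ)⟩⟩
  · intro h
    refine ⟨hC, fun x => ⟨fun hx => ⟨hC.1 hx, fun φ hφ => ?_⟩, fun ⟨hx, hx'⟩ => ?_⟩⟩
    · have hmem : (⟨x, hC.1 hx⟩ : A.adjoint.domain) ∈ A.adjointGraphOrthogonal M := h ▸ hx
      exact adjointGraphInner_eq_zero_symm (hmem φ hφ)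
    · have hmem : (⟨x, hx⟩ : A.adjoint.domain) ∈ A.adjointGraphOrthogonal M :=
        fun φ hφ => adjointGraphInner_eq_zero_symm (hx' φ hφ)
      rw [← h] at hmem
      exact hmem

theorem adjointGraphImage_comap_domain {C : H →ₗ.[ℂ] H} (hC : C ≤ A.adjoint) :
    A.adjointGraphImage (C.domain.comap A.adjoint.domain.subtype) = C.graph := by
  ext x
  rw [mem_adjointGraphImage, mem_graph_iff]
  constructor
  · rintro ⟨φ, hφ, rfl⟩
    exact ⟨⟨φ, hφ⟩, rfl, hC.2 rfl⟩
  · rintro ⟨y, h1, h2⟩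
    exact ⟨⟨y, hC.1 y.2⟩, y.2, Prod.ext h1 ((hC.2 rfl).symm.trans h2)⟩

theorem adjoint_apply_eq_zero_of_mem_adjointGraphOrthogonal (hA : Dense (A.domain : Set H))
    {K : Submodule ℂ A.adjoint.domain} (hK : Dense (K.map A.adjoint.domain.subtype : Set H))
    {φ : A.adjoint.domain} (hφ : φ ∈ A.adjointGraphOrthogonal K)
    (hdom : A.adjoint φ ∈ A.domain) : A.adjoint φ = 0 := by
  have hadj (f : A.adjoint.domain) : ⟪A.adjoint f, A.adjoint φ⟫ = ⟪(f : H), A ⟨_, hdom⟩⟫ :=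
    adjoint_isFormalAdjoint hA f ⟨_, hdom⟩
  have hsum : (φ : H) + A ⟨_, hdom⟩ = 0 := by
    refine hK.eq_zero_of_inner_right ℂ ?_
    rintro _ ⟨f, hf, rfl⟩
    have h := hφ f hf
    rw [adjointGraphInner, hadj, ← inner_add_right] at h
    exact h
  have hself : A.adjointGraphInner φ φ = 0 := by
    rw [adjointGraphInner, hadj, ← inner_add_right, hsum, inner_zero_right]
  rw [eq_zero_of_adjointGraphInner_self hself, map_zero]

theorem eq_zero_of_mem_adjointGraphOrthogonal
    {K : Submodule ℂ A.adjoint.domain} (hK : Dense (K.map A.adjoint.domain.subtype : Set H))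
    {φ : A.adjoint.domain} (hφ : φ ∈ A.adjointGraphOrthogonal K)
    (hker : A.adjoint φ = 0) : φ = 0 := by
  refine Subtype.ext (hK.eq_zero_of_inner_right ℂ ?_)
  rintro _ ⟨f, hf, rfl⟩
  have h := hφ f hf
  rwa [adjointGraphInner, hker, inner_zero_right, add_zero] at h

end LinearPMap

open LinearPMap

theorem statement11
    {H : Type*} [NormedAddCommGroup H] [InnerProductSpace ℂ H] [CompleteSpace H]
    (A : H →ₗ.[ℂ] H) (hA : Dense (A.domain : Set H)) (hAclosable : A.IsClosable)
    (hAadj : Dense (A.adjoint.domain : Set H))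
    (C : H →ₗ.[ℂ] H) (hCdense : Dense (C.domain : Set H)) (hCclosed : C.IsClosed)
    (hCrestr : C ≤ A.adjoint) :
    ∃! M : Submodule ℂ A.adjoint.domain,
      graphNormClosure A M ⊆ (M : Set A.adjoint.domain) ∧
      (∀ φ : A.adjoint.domain, φ ∈ M → A.adjoint φ = 0 → φ = 0) ∧
      (∀ φ : A.adjoint.domain, φ ∈ M → A.adjoint φ ∈ A.domain → A.adjoint φ = 0) ∧
      IsCM A M C := by
  let K : Submodule ℂ A.adjoint.domain := C.domain.comap A.adjoint.domain.subtype
  have hKclosed : IsClosed (A.adjointGraphImage K : Set (H × H)) := by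
    rw [adjointGraphImage_comap_domain hCrestr]
    exact hCclosed
  have hKdense : Dense (K.map A.adjoint.domain.subtype : Set H) :=
    hCdense.mono fun x hx => ⟨⟨x, hCrestr.1 hx⟩, hx, rfl⟩
  refine ⟨A.adjointGraphOrthogonal K, ⟨graphNormClosure_adjointGraphOrthogonal_subset K,
    fun φ hφ => eq_zero_of_mem_adjointGraphOrthogonal hKdense hφ,
    fun φ hφ => adjoint_apply_eq_zero_of_mem_adjointGraphOrthogonal hA hKdense hφ,
    (isCM_iff hCrestr).mpr (adjointGraphOrthogonal_orthogonal hKclosed).symm⟩, ?_⟩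
  rintro M ⟨hM, -, -, hCM⟩
  have hKM : K = A.adjointGraphOrthogonal M := (isCM_iff hCrestr).mp hCM
  rw [hKM, adjointGraphOrthogonal_orthogonal (isClosed_adjointGraphImage hA hM)]
end

section
/- (Theorem 4.2 (i)) Let A be a densely defined closed operator on a complex Hilbert space H with adjoint A*. Let M ⊂ D(A*) and, for each n ∈ ℕ, M_n ⊂ D(A*) be linear subspaces closed with respect to the graph norm of A*, and set Γ_N := {(φ, A*φ) : φ ∈ N} ⊂ H ⊕ H for a subspace N ⊂ D(A*). Let C_N denote the restriction of A* to {f ∈ D(A*) : ⟨f, φ⟩ + ⟨A*f, A*φ⟩ = 0 for all φ ∈ N}. Then ‖P(Γ(C_{M_n})) − P(Γ(C_M))‖ → 0 as n → ∞ if and only if ‖P(Γ_{M_n}) − P(Γ_M)‖ → 0 as n → ∞, where P(K) denotes the orthogonal projection in H ⊕ H onto the closed subspace K and ‖·‖ is the operator norm. -/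
/- STATEMENT 13 (Theorem 4.2 (i)): For graph-norm-closed subspaces `M`, `Mₙ ⊆ D(A*)`,
the operators `C_{Mₙ}` converge to `C_M` in the generalized (Kato) sense, i.e.
`‖P(Γ(C_{Mₙ})) - P(Γ(C_M))‖ → 0` in `H ⊕ H = WithLp 2 (H × H)`, if and only if
`‖P(Γ_{Mₙ}) - P(Γ_M)‖ → 0`, where `Γ_N = {(φ, A*φ) : φ ∈ N}`. -/

open scoped ComplexInnerProductSpace

/-- `P` is the orthogonal projection of `E` onto the subspace `K`. -/
def IsOrthProjOnto {E : Type*} [NormedAddCommGroup E] [InnerProductSpace ℂ E]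
    (K : Submodule ℂ E) (P : E →L[ℂ] E) : Prop :=
  ∀ x : E, P x ∈ K ∧ x - P x ∈ Kᗮ

/-- `M` is closed in `D(A*)` with respect to the graph norm of `A*`. -/
def GraphNormClosed {H : Type*} [NormedAddCommGroup H] [InnerProductSpace ℂ H]
    [CompleteSpace H] (A : H →ₗ.[ℂ] H) (M : Submodule ℂ A.adjoint.domain) : Prop :=
  ∀ φ : A.adjoint.domain,
    ((φ : H), A.adjoint φ) ∈
      closure ((fun ψ : A.adjoint.domain => ((ψ : H), A.adjoint ψ)) '' M) → φ ∈ M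

/-- The orthogonal projection onto a subspace is unique. -/
theorem IsOrthProjOnto.unique {E : Type*} [NormedAddCommGroup E] [InnerProductSpace ℂ E]
    {K : Submodule ℂ E} {P Q : E →L[ℂ] E} (hP : IsOrthProjOnto K P) (hQ : IsOrthProjOnto K Q) :
    P = Q := by
  ext1 x
  have hK : P x - Q x ∈ K := K.sub_mem (hP x).1 (hQ x).1
  have hKo : P x - Q x ∈ Kᗮ := by
    simpa using Kᗮ.sub_mem (hQ x).2 (hP x).2
  exact sub_eq_zero.1 (inner_self_eq_zero.1 (hKo _ hK))

/-- If `K ≤ G`, the projections onto `K` and onto its complement in `G` add up to the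
projection onto `G`. -/
theorem IsOrthProjOnto.add_of_le {E : Type*} [NormedAddCommGroup E] [InnerProductSpace ℂ E]
    {K G : Submodule ℂ E} {P Q : E →L[ℂ] E} (hKG : K ≤ G) (hP : IsOrthProjOnto K P)
    (hQ : IsOrthProjOnto (G ⊓ Kᗮ) Q) : IsOrthProjOnto G (P + Q) := by
  intro x
  refine ⟨G.add_mem (hKG (hP x).1) (hQ x).1.1, fun g hg => ?_⟩
  have hc : g - P g ∈ G ⊓ Kᗮ := ⟨G.sub_mem hg (hKG (hP g).1), (hP g).2⟩
  have h₁ : ⟪P g, x - P x⟫ = 0 := (hP x).2 _ (hP g).1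
  have h₂ : ⟪P g, Q x⟫ = 0 := (hQ x).1.2 _ (hP g).1
  have h₃ : ⟪g - P g, x - Q x⟫ = 0 := (hQ x).2 _ hc
  have h₄ : ⟪g - P g, P x⟫ = 0 := Submodule.inner_left_of_mem_orthogonal (hP x).1 hc.2
  calc ⟪g, x - (P + Q) x⟫
      = ⟪P g, x - P x⟫ - ⟪P g, Q x⟫ + (⟪g - P g, x - Q x⟫ - ⟪g - P g, P x⟫) := by
        simp only [add_apply, inner_sub_left, inner_sub_right, inner_add_right]
        ring
    _ = 0 := by rw [h₁, h₂, h₃, h₄]; simp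

/-- The graph of `A*` restricted to `M` is contained in the graph of `A*`. -/
theorem map_prod_le_adjoint_graph {H : Type*} [NormedAddCommGroup H] [InnerProductSpace ℂ H]
    [CompleteSpace H] (A : H →ₗ.[ℂ] H) (M : Submodule ℂ A.adjoint.domain) :
    M.map (A.adjoint.domain.subtype.prod A.adjoint.toFun) ≤ A.adjoint.graph := by
  rintro _ ⟨φ, -, rfl⟩
  exact A.adjoint.mem_graph φ

/-- The graph of `C_M` is the orthogonal complement of `Γ_M` in the graph of `A*`. -/
theorem IsCM.map_graph_eq {H : Type*} [NormedAddCommGroup H] [InnerProductSpace ℂ H]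
    [CompleteSpace H] {A : H →ₗ.[ℂ] H} {M : Submodule ℂ A.adjoint.domain} {C : H →ₗ.[ℂ] H}
    (hC : IsCM A M C) :
    C.graph.map ((WithLp.linearEquiv 2 ℂ (H × H)).symm : (H × H) →ₗ[ℂ] WithLp 2 (H × H)) =
      A.adjoint.graph.map
          ((WithLp.linearEquiv 2 ℂ (H × H)).symm : (H × H) →ₗ[ℂ] WithLp 2 (H × H)) ⊓
        ((M.map (A.adjoint.domain.subtype.prod A.adjoint.toFun)).map
          ((WithLp.linearEquiv 2 ℂ (H × H)).symm : (H × H) →ₗ[ℂ] WithLp 2 (H × H)))ᗮ := by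
  obtain ⟨hle, hdom⟩ := hC
  ext z
  constructor
  · rintro ⟨p, hp, rfl⟩
    have hpA := LinearPMap.le_graph_of_le hle hp
    refine ⟨⟨p, hpA, rfl⟩, ?_⟩
    obtain ⟨hx, horth⟩ := (hdom p.1).1 (LinearPMap.mem_domain_of_mem_graph hp)
    obtain ⟨y, hy₁, hy₂⟩ := A.adjoint.mem_graph_iff.1 hpA
    obtain rfl : y = ⟨p.1, hx⟩ := Subtype.ext hy₁
    rw [SetLike.mem_coe, Submodule.mem_orthogonal']
    rintro _ ⟨_, ⟨φ, hφ, rfl⟩, rfl⟩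
    have h := horth φ hφ
    rw [hy₂] at h
    simpa [WithLp.prod_inner_apply] using h
  · rintro ⟨⟨p, hpA, rfl⟩, horth⟩
    refine ⟨p, ?_, rfl⟩
    obtain ⟨y, hy₁, hy₂⟩ := A.adjoint.mem_graph_iff.1 hpA
    have hpC : p.1 ∈ C.domain := by
      refine (hdom p.1).2 ⟨hy₁ ▸ y.2, fun φ hφ => ?_⟩
      rw [SetLike.mem_coe, Submodule.mem_orthogonal'] at horth
      have h := horth _ ⟨_, ⟨φ, hφ, rfl⟩, rfl⟩
      have hy : (⟨p.1, hy₁ ▸ y.2⟩ : A.adjoint.domain) = y := Subtype.ext hy₁.symm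
      rw [hy, hy₂]
      simpa [WithLp.prod_inner_apply] using h
    refine C.mem_graph_iff.2 ⟨⟨p.1, hpC⟩, rfl, ?_⟩
    rw [← hy₂]
    exact hle.2 hy₁.symm

theorem statement13
    {H : Type*} [NormedAddCommGroup H] [InnerProductSpace ℂ H] [CompleteSpace H]
    (A : H →ₗ.[ℂ] H) (hA : Dense (A.domain : Set H)) (hAclosed : A.IsClosed)
    (M : Submodule ℂ A.adjoint.domain) (Mseq : ℕ → Submodule ℂ A.adjoint.domain)
    (hM : GraphNormClosed A M) (hMseq : ∀ n, GraphNormClosed A (Mseq n))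
    (C : H →ₗ.[ℂ] H) (hC : IsCM A M C)
    (Cseq : ℕ → H →ₗ.[ℂ] H) (hCseq : ∀ n, IsCM A (Mseq n) (Cseq n))
    (PC PM : WithLp 2 (H × H) →L[ℂ] WithLp 2 (H × H))
    (PCseq PMseq : ℕ → (WithLp 2 (H × H) →L[ℂ] WithLp 2 (H × H)))
    (hPC : IsOrthProjOnto (C.graph.map
      ((WithLp.linearEquiv 2 ℂ (H × H)).symm : (H × H) →ₗ[ℂ] WithLp 2 (H × H))) PC)
    (hPCseq : ∀ n, IsOrthProjOnto ((Cseq n).graph.map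
      ((WithLp.linearEquiv 2 ℂ (H × H)).symm : (H × H) →ₗ[ℂ] WithLp 2 (H × H))) (PCseq n))
    (hPM : IsOrthProjOnto ((M.map (A.adjoint.domain.subtype.prod A.adjoint.toFun)).map
      ((WithLp.linearEquiv 2 ℂ (H × H)).symm : (H × H) →ₗ[ℂ] WithLp 2 (H × H))) PM)
    (hPMseq : ∀ n, IsOrthProjOnto
      (((Mseq n).map (A.adjoint.domain.subtype.prod A.adjoint.toFun)).map
        ((WithLp.linearEquiv 2 ℂ (H × H)).symm : (H × H) →ₗ[ℂ] WithLp 2 (H × H)))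
      (PMseq n)) :
    Filter.Tendsto (fun n => ‖PCseq n - PC‖) Filter.atTop (nhds 0) ↔
      Filter.Tendsto (fun n => ‖PMseq n - PM‖) Filter.atTop (nhds 0) := by
  have hsum : ∀ n, PMseq n + PCseq n = PM + PC := fun n =>
    (IsOrthProjOnto.add_of_le (Submodule.map_mono (map_prod_le_adjoint_graph A (Mseq n)))
      (hPMseq n) ((hCseq n).map_graph_eq ▸ hPCseq n)).unique
    (IsOrthProjOnto.add_of_le (Submodule.map_mono (map_prod_le_adjoint_graph A M))
      hPM (hC.map_graph_eq ▸ hPC))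
  have hnorm : ∀ n, ‖PCseq n - PC‖ = ‖PMseq n - PM‖ := fun n => by
    rw [← norm_neg (PMseq n - PM), neg_sub]
    congr 1
    rw [sub_eq_sub_iff_add_eq_add, add_comm, hsum n]
  simp only [hnorm]
end

section
/- (Theorem 4.2 (ii)) Let A be a densely defined closed operator on a complex Hilbert space H with adjoint A*. Let M ⊂ D(A*) and, for each n ∈ ℕ, M_n ⊂ D(A*) be linear subspaces closed with respect to the graph norm of A* and satisfying ker(A*) ∩ M = {0} and {A*φ : φ ∈ M} ∩ D(A) = {0} (and likewise for each M_n). Let A_N (for N = M or M_n) be the operator with domain D(A) ∔ {A*φ : φ ∈ N} acting by f + A*φ ↦ Af − φ, which is closed, and set Γ_N := {(φ, A*φ) : φ ∈ N} ⊂ H ⊕ H. Then ‖P(Γ(A_{M_n})) − P(Γ(A_M))‖ → 0 as n → ∞ if and only if ‖P(Γ_{M_n}) − P(Γ_M)‖ → 0 as n → ∞. -/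
/-- The conditions `ker A* ∩ N = {0}` and `{A*φ : φ ∈ N} ∩ D(A) = {0}`. -/
def SepConds {H : Type*} [NormedAddCommGroup H] [InnerProductSpace ℂ H]
    [CompleteSpace H] (A : H →ₗ.[ℂ] H) (N : Submodule ℂ A.adjoint.domain) : Prop :=
  (∀ φ : A.adjoint.domain, φ ∈ N → A.adjoint φ = 0 → φ = 0) ∧
  (∀ φ : A.adjoint.domain, φ ∈ N → A.adjoint φ ∈ A.domain → A.adjoint φ = 0)

namespace IsOrthProjOnto

variable {E : Type*} [NormedAddCommGroup E] [InnerProductSpace ℂ E]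

theorem unique_s14 {K : Submodule ℂ E} {P Q : E →L[ℂ] E}
    (hP : IsOrthProjOnto K P) (hQ : IsOrthProjOnto K Q) : P = Q := by
  ext x
  have hK : P x - Q x ∈ K := K.sub_mem (hP x).1 (hQ x).1
  have hKperp : P x - Q x ∈ Kᗮ := by
    have := Kᗮ.sub_mem (hQ x).2 (hP x).2
    rwa [sub_sub_sub_cancel_left] at this
  exact sub_eq_zero.mp (inner_self_eq_zero.mp (hKperp _ hK))

theorem of_isClosed [CompleteSpace E] {K : Submodule ℂ E} (hK : IsClosed (K : Set E)) :
    ∃ P : E →L[ℂ] E, IsOrthProjOnto K P := by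
  have : CompleteSpace K := hK.completeSpace_coe
  exact ⟨K.starProjection, fun x =>
    ⟨K.starProjection_apply_mem x, K.sub_starProjection_mem_orthogonal x⟩⟩

theorem add {K L : Submodule ℂ E} {P Q : E →L[ℂ] E}
    (hP : IsOrthProjOnto K P) (hQ : IsOrthProjOnto L Q) (hKL : K ⟂ L) :
    IsOrthProjOnto (K ⊔ L) (P + Q) := by
  intro x
  refine ⟨Submodule.add_mem_sup (hP x).1 (hQ x).1, ?_⟩
  rw [← Submodule.inf_orthogonal]
  constructor
  · have := Kᗮ.sub_mem (hP x).2 (hKL.symm (hQ x).1)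
    rwa [sub_sub] at this
  · have := Lᗮ.sub_mem (hQ x).2 (hKL (hP x).1)
    rwa [sub_sub, add_comm] at this

theorem map {K : Submodule ℂ E} {P : E →L[ℂ] E} (hP : IsOrthProjOnto K P) (W : E ≃ₗᵢ[ℂ] E) :
    IsOrthProjOnto (K.map (W.toLinearEquiv : E →ₗ[ℂ] E))
      ((W : E →L[ℂ] E) ∘L P ∘L (W.symm : E →L[ℂ] E)) := by
  intro x
  refine ⟨Submodule.mem_map_of_mem (hP (W.symm x)).1, ?_⟩
  rintro _ ⟨y, hy, rfl⟩
  have := (hP (W.symm x)).2 y hy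
  rw [← W.inner_map_map, map_sub, W.apply_symm_apply] at this
  exact this

end IsOrthProjOnto

theorem LinearIsometryEquiv.norm_conj {E : Type*} [NormedAddCommGroup E] [InnerProductSpace ℂ E]
    (W : E ≃ₗᵢ[ℂ] E) (T : E →L[ℂ] E) :
    ‖(W : E →L[ℂ] E) ∘L T ∘L (W.symm : E →L[ℂ] E)‖ = ‖T‖ :=
  (W.toLinearIsometry.norm_toContinuousLinearMap_comp).trans
    (T.opNorm_comp_linearIsometryEquiv W.symm)

section Extension

variable {H : Type*} [NormedAddCommGroup H] [InnerProductSpace ℂ H]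

variable (H) in
/-- The unitary `(φ, ψ) ↦ (ψ, -φ)` of `H ⊕ H`. -/
noncomputable def skewSwapL2 : WithLp 2 (H × H) ≃ₗᵢ[ℂ] WithLp 2 (H × H) where
  toLinearEquiv := (LinearEquiv.skewSwap ℂ H H).symm.withLpCongr 2
  norm_map' x := by
    rw [← sq_eq_sq₀ (norm_nonneg _) (norm_nonneg _), WithLp.prod_norm_sq_eq_of_L2,
      WithLp.prod_norm_sq_eq_of_L2]
    simp [add_comm]

/-- A subspace of `H × H` viewed in the Hilbert space `H ⊕ H`. -/
noncomputable abbrev Submodule.toL2 (K : Submodule ℂ (H × H)) : Submodule ℂ (WithLp 2 (H × H)) :=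
  K.map ((WithLp.linearEquiv 2 ℂ (H × H)).symm : (H × H) →ₗ[ℂ] WithLp 2 (H × H))

theorem Submodule.isClosed_toL2 {K : Submodule ℂ (H × H)} (hK : IsClosed (K : Set (H × H))) :
    IsClosed (K.toL2 : Set (WithLp 2 (H × H))) :=
  (WithLp.prodContinuousLinearEquiv 2 ℂ H H).symm.toHomeomorph.isClosedMap _ hK

variable [CompleteSpace H]

/-- The restriction of the graph of `A*` to a subspace `N` of its domain. -/
noncomputable abbrev LinearPMap.adjointGraphOn (A : H →ₗ.[ℂ] H)
    (N : Submodule ℂ A.adjoint.domain) : Submodule ℂ (H × H) :=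
  N.map (A.adjoint.domain.subtype.prod A.adjoint.toFun)

theorem LinearPMap.graph_isOrtho_skewSwap_adjointGraphOn {A : H →ₗ.[ℂ] H}
    (hA : Dense (A.domain : Set H)) (N : Submodule ℂ A.adjoint.domain) :
    A.graph.toL2 ⟂ (A.adjointGraphOn N).toL2.map
      ((skewSwapL2 H).toLinearEquiv : WithLp 2 (H × H) →ₗ[ℂ] WithLp 2 (H × H)) := by
  rw [Submodule.isOrtho_comm, Submodule.isOrtho_iff_inner_eq]
  rintro _ ⟨_, ⟨_, ⟨φ, -, rfl⟩, rfl⟩, rfl⟩ _ ⟨x, hx, rfl⟩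
  obtain ⟨f, rfl⟩ := (A.mem_graph_iff').mp hx
  have := A.adjoint_isFormalAdjoint hA φ f
  simpa [skewSwapL2, sub_eq_zero, ← sub_eq_add_neg] using this

theorem IsExtAM.graph_eq_sup {A B : H →ₗ.[ℂ] H} {N : Submodule ℂ A.adjoint.domain}
    (hB : IsExtAM A N B) :
    B.graph.toL2 = A.graph.toL2 ⊔ (A.adjointGraphOn N).toL2.map
      ((skewSwapL2 H).toLinearEquiv : WithLp 2 (H × H) →ₗ[ℂ] WithLp 2 (H × H)) := by
  obtain ⟨hdom, hval⟩ := hB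
  have hmem (f : A.domain) (φ : A.adjoint.domain) (hφ : φ ∈ N) :
      (f : H) + A.adjoint φ ∈ B.domain :=
    hdom ▸ Submodule.add_mem_sup f.2 (Submodule.mem_map_of_mem hφ)
  have hgraph (f : A.domain) (φ : A.adjoint.domain) (hφ : φ ∈ N) :
      ((f : H) + A.adjoint φ, A f - φ) ∈ B.graph :=
    hval f φ hφ (hmem f φ hφ) ▸ B.mem_graph ⟨_, hmem f φ hφ⟩
  apply le_antisymm
  · rintro _ ⟨x, hx, rfl⟩
    obtain ⟨⟨y, hy⟩, rfl⟩ := (B.mem_graph_iff').mp hx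
    obtain ⟨f, hf, _, ⟨φ, hφ, rfl⟩, rfl⟩ := Submodule.mem_sup.mp (hdom ▸ hy)
    refine Submodule.mem_sup.mpr ⟨_, Submodule.mem_map_of_mem (A.mem_graph ⟨f, hf⟩), _,
      Submodule.mem_map_of_mem (Submodule.mem_map_of_mem (Submodule.mem_map_of_mem hφ)), ?_⟩
    have := hval ⟨f, hf⟩ φ hφ hy
    apply (WithLp.linearEquiv 2 ℂ (H × H)).injective
    refine Prod.ext rfl ?_
    exact (sub_eq_add_neg _ _).symm.trans this.symm
  · refine sup_le ?_ ?_
    · rintro _ ⟨x, hx, rfl⟩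
      obtain ⟨f, rfl⟩ := (A.mem_graph_iff').mp hx
      refine Submodule.mem_map_of_mem ?_
      simpa using hgraph f 0 N.zero_mem
    · rintro _ ⟨_, ⟨_, ⟨φ, hφ, rfl⟩, rfl⟩, rfl⟩
      refine ⟨(A.adjoint φ, -(φ : H)), ?_, rfl⟩
      simpa using hgraph 0 φ hφ

end Extension

theorem statement14
    {H : Type*} [NormedAddCommGroup H] [InnerProductSpace ℂ H] [CompleteSpace H]
    (A : H →ₗ.[ℂ] H) (hA : Dense (A.domain : Set H)) (hAclosed : A.IsClosed)
    (M : Submodule ℂ A.adjoint.domain) (Mseq : ℕ → Submodule ℂ A.adjoint.domain)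
    (hM : GraphNormClosed A M) (hMseq : ∀ n, GraphNormClosed A (Mseq n))
    (hMsep : SepConds A M) (hMseqsep : ∀ n, SepConds A (Mseq n))
    (B : H →ₗ.[ℂ] H) (hB : IsExtAM A M B)
    (Bseq : ℕ → H →ₗ.[ℂ] H) (hBseq : ∀ n, IsExtAM A (Mseq n) (Bseq n))
    (PB PM : WithLp 2 (H × H) →L[ℂ] WithLp 2 (H × H))
    (PBseq PMseq : ℕ → (WithLp 2 (H × H) →L[ℂ] WithLp 2 (H × H)))
    (hPB : IsOrthProjOnto (B.graph.map
      ((WithLp.linearEquiv 2 ℂ (H × H)).symm : (H × H) →ₗ[ℂ] WithLp 2 (H × H))) PB)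
    (hPBseq : ∀ n, IsOrthProjOnto ((Bseq n).graph.map
      ((WithLp.linearEquiv 2 ℂ (H × H)).symm : (H × H) →ₗ[ℂ] WithLp 2 (H × H))) (PBseq n))
    (hPM : IsOrthProjOnto ((M.map (A.adjoint.domain.subtype.prod A.adjoint.toFun)).map
      ((WithLp.linearEquiv 2 ℂ (H × H)).symm : (H × H) →ₗ[ℂ] WithLp 2 (H × H))) PM)
    (hPMseq : ∀ n, IsOrthProjOnto
      (((Mseq n).map (A.adjoint.domain.subtype.prod A.adjoint.toFun)).map
        ((WithLp.linearEquiv 2 ℂ (H × H)).symm : (H × H) →ₗ[ℂ] WithLp 2 (H × H)))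
      (PMseq n)) :
    Filter.Tendsto (fun n => ‖PBseq n - PB‖) Filter.atTop (nhds 0) ↔
      Filter.Tendsto (fun n => ‖PMseq n - PM‖) Filter.atTop (nhds 0) := by
  obtain ⟨PA, hPA⟩ := IsOrthProjOnto.of_isClosed (Submodule.isClosed_toL2 hAclosed)
  have decomp {N : Submodule ℂ A.adjoint.domain} {C : H →ₗ.[ℂ] H}
      {PC PN : WithLp 2 (H × H) →L[ℂ] WithLp 2 (H × H)} (hC : IsExtAM A N C)
      (hPC : IsOrthProjOnto C.graph.toL2 PC)
      (hPN : IsOrthProjOnto (A.adjointGraphOn N).toL2 PN) :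
      PC = PA + (skewSwapL2 H : WithLp 2 (H × H) →L[ℂ] WithLp 2 (H × H)) ∘L PN ∘L
        ((skewSwapL2 H).symm : WithLp 2 (H × H) →L[ℂ] WithLp 2 (H × H)) :=
    hPC.unique_s14 (hC.graph_eq_sup ▸ hPA.add (hPN.map (skewSwapL2 H))
      (A.graph_isOrtho_skewSwap_adjointGraphOn hA N))
  have hnorm (n : ℕ) : ‖PBseq n - PB‖ = ‖PMseq n - PM‖ := by
    rw [decomp hB hPB hPM, decomp (hBseq n) (hPBseq n) (hPMseq n), add_sub_add_left_eq_sub,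
      ← ContinuousLinearMap.comp_sub, ← ContinuousLinearMap.sub_comp,
      LinearIsometryEquiv.norm_conj]
  simp_rw [hnorm]
end

section
/- Let S be a densely defined selfadjoint operator on a complex Hilbert space H, and let φ ∈ D(S) with φ ≠ 0 and Sφ ∉ D(S). Define the operator C_φ as the restriction of S to the domain D(C_φ) = {f ∈ D(S) : ⟨φ, f⟩ + ⟨Sφ, Sf⟩ = 0}. Then C_φ is densely defined, closed, and symmetric (i.e. ⟨C_φ f, g⟩ = ⟨f, C_φ g⟩ for all f, g ∈ D(C_φ)), and φ ∉ D(C_φ), so C_φ is a proper restriction of S. -/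
/- STATEMENT 15: For a densely defined selfadjoint `S` and `φ ∈ D(S)`, `φ ≠ 0`,
`Sφ ∉ D(S)`, the restriction `C_φ` of `S` to
`{f ∈ D(S) : ⟪φ, f⟫ + ⟪Sφ, Sf⟫ = 0}` is densely defined, closed and symmetric,
and `φ ∉ D(C_φ)`, so `C_φ` is a proper restriction of `S`. -/

open scoped ComplexInnerProductSpace

namespace LinearPMap

variable {H : Type*} [NormedAddCommGroup H] [InnerProductSpace ℂ H]

/-- The graph inner product of `φ` with itself does not vanish for `φ ≠ 0`. -/
lemma graph_inner_self_ne_zero (S : H →ₗ.[ℂ] H) {φ : S.domain} (hφ : (φ : H) ≠ 0) :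
    ⟪(φ : H), (φ : H)⟫ + ⟪S φ, S φ⟫ ≠ 0 := by
  rw [inner_self_eq_norm_sq_to_K, inner_self_eq_norm_sq_to_K,
    ← RCLike.ofReal_pow, ← RCLike.ofReal_pow, ← RCLike.ofReal_add, RCLike.ofReal_ne_zero]
  have h : 0 < ‖(φ : H)‖ ^ 2 + ‖S φ‖ ^ 2 := by
    have := norm_pos_iff.mpr hφ
    positivity
  exact ne_of_gt h

/-- The restriction of a closed operator to the graph-orthogonal complement of a vector of its
domain is closed. -/
lemma IsClosed.of_restrict_graph_orthogonal {S C : H →ₗ.[ℂ] H} (hS : S.IsClosed)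
    (φ : S.domain) (hCS : C ≤ S)
    (hC : ∀ x : H, x ∈ C.domain ↔ ∃ hx : x ∈ S.domain,
      ⟪(φ : H), x⟫ + ⟪S φ, S ⟨x, hx⟩⟫ = 0) : C.IsClosed := by
  have hgraph : (C.graph : Set (H × H)) =
      (S.graph : Set (H × H)) ∩ {p | ⟪(φ : H), p.1⟫ + ⟪S φ, p.2⟫ = 0} := by
    ext ⟨x, y⟩
    simp only [SetLike.mem_coe, Set.mem_inter_iff, Set.mem_ofPred_eq]
    constructor
    · intro hxy
      have hxyS := le_graph_of_le hCS hxy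
      obtain ⟨z, rfl, rfl⟩ := (mem_graph_iff _).mp hxy
      obtain ⟨hz, h0⟩ := (hC z).mp z.2
      exact ⟨hxyS, by rwa [hCS.2 (y := ⟨z, hz⟩) rfl]⟩
    · rintro ⟨hxy, h0⟩
      obtain ⟨z, rfl, rfl⟩ := (mem_graph_iff _).mp hxy
      have hz : (z : H) ∈ C.domain := (hC z).mpr ⟨z.2, h0⟩
      exact (mem_graph_iff _).mpr ⟨⟨z, hz⟩, rfl, hCS.2 rfl⟩
  unfold LinearPMap.IsClosed at hS ⊢
  rw [hgraph]
  exact hS.inter (isClosed_eq (by fun_prop) continuous_const)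

/-- If `S φ` is not in the domain of the adjoint of `S`, the graph-orthogonal complement of `φ` in
the domain of `S` is dense. -/
lemma dense_graph_orthogonal [CompleteSpace H] {S : H →ₗ.[ℂ] H}
    (hS : Dense (S.domain : Set H)) {φ : S.domain} (hφ : (φ : H) ≠ 0)
    (hSφ : S φ ∉ S.adjoint.domain) {D : Submodule ℂ H}
    (hD : ∀ x : S.domain, ⟪(φ : H), (x : H)⟫ + ⟪S φ, S x⟫ = 0 → (x : H) ∈ D) :
    Dense (D : Set H) := by
  rw [Submodule.dense_iff_topologicalClosure_eq_top,
    Submodule.topologicalClosure_eq_top_iff, Submodule.eq_bot_iff]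
  intro h hh
  set N : ℂ := ⟪(φ : H), (φ : H)⟫ + ⟪S φ, S φ⟫ with hN
  have hN0 : N ≠ 0 := graph_inner_self_ne_zero S hφ
  have key : ∀ f : S.domain,
      ⟪h, (f : H)⟫ = ((⟪(φ : H), (f : H)⟫ + ⟪S φ, S f⟫) / N) * ⟪h, (φ : H)⟫ := by
    intro f
    set a : ℂ := (⟪(φ : H), (f : H)⟫ + ⟪S φ, S f⟫) / N with ha
    have haN : a * N = ⟪(φ : H), (f : H)⟫ + ⟪S φ, S f⟫ := div_mul_cancel₀ _ hN0
    have hmem : ((f - a • φ : S.domain) : H) ∈ D := by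
      apply hD
      rw [map_sub, map_smul, Submodule.coe_sub, Submodule.coe_smul, inner_sub_right,
        inner_sub_right, inner_smul_right, inner_smul_right]
      linear_combination -haN + a * hN
    have h0 := (Submodule.mem_orthogonal' D h).mp hh _ hmem
    rw [Submodule.coe_sub, Submodule.coe_smul, inner_sub_right, inner_smul_right] at h0
    exact sub_eq_zero.mp h0
  by_cases hc : ⟪h, (φ : H)⟫ = 0
  · refine hS.eq_zero_of_inner_left (𝕜 := ℂ) fun f hf => ?_
    rw [key ⟨f, hf⟩, hc, mul_zero]
  · refine absurd (mem_adjoint_domain_of_exists _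
      ⟨(starRingEnd ℂ) (N / ⟪h, (φ : H)⟫) • h - (φ : H), fun f => ?_⟩) hSφ
    rw [inner_sub_left, inner_smul_left, Complex.conj_conj, key f]
    field_simp
    ring

end LinearPMap

theorem statement15
    {H : Type*} [NormedAddCommGroup H] [InnerProductSpace ℂ H] [CompleteSpace H]
    (S : H →ₗ.[ℂ] H) (hSdense : Dense (S.domain : Set H)) (hS : IsSelfAdjoint S)
    (φ : S.domain) (hφ : (φ : H) ≠ 0) (hSφ : S φ ∉ S.domain)
    (C : H →ₗ.[ℂ] H) (hCrestr : C ≤ S)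
    (hCdom : ∀ x : H, x ∈ C.domain ↔ ∃ hx : x ∈ S.domain,
      ⟪(φ : H), x⟫ + ⟪S φ, S ⟨x, hx⟩⟫ = 0) :
    Dense (C.domain : Set H) ∧ C.IsClosed ∧
    (∀ f g : C.domain, ⟪C f, (g : H)⟫ = ⟪(f : H), C g⟫) ∧
    (φ : H) ∉ C.domain := by
  have hadj : S.adjoint = S := hS
  have hsymm : S.IsFormalAdjoint S := by
    simpa only [hadj] using LinearPMap.adjoint_isFormalAdjoint hSdense
  refine ⟨LinearPMap.dense_graph_orthogonal hSdense hφ (by rwa [hadj])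
      fun x hx => (hCdom x).mpr ⟨x.2, hx⟩,
    hS.isClosed.of_restrict_graph_orthogonal φ hCrestr hCdom, fun f g => ?_, fun hmem => ?_⟩
  · rw [hCrestr.2 (x := f) (y := ⟨f, hCrestr.1 f.2⟩) rfl,
      hCrestr.2 (x := g) (y := ⟨g, hCrestr.1 g.2⟩) rfl]
    exact hsymm ⟨f, hCrestr.1 f.2⟩ ⟨g, hCrestr.1 g.2⟩
  · obtain ⟨_, h0⟩ := (hCdom φ).mp hmem
    exact LinearPMap.graph_inner_self_ne_zero S hφ h0
end

section
/- Let S be a densely defined selfadjoint operator on a complex Hilbert space H, and let φ ∈ D(S) with φ ≠ 0 and Sφ ∉ D(S). Let C_φ be the restriction of S to D(C_φ) = {f ∈ D(S) : ⟨φ, f⟩ + ⟨Sφ, Sf⟩ = 0}. Then the adjoint C_φ* has domain D(C_φ*) = D(S) ∔ span{Sφ} (a direct sum), and C_φ*(f + λ Sφ) = Sf − λφ for all f ∈ D(S) and λ ∈ ℂ. -/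
/- STATEMENT 16: With `S`, `φ`, `C_φ` as in Statement 15, the adjoint `C_φ*` has
domain `D(S) ∔ span{Sφ}` (a direct sum) and acts by `f + λ·Sφ ↦ Sf - λ·φ`. -/

open scoped ComplexInnerProductSpace

namespace LinearPMap

variable {H : Type*} [NormedAddCommGroup H] [InnerProductSpace ℂ H] [CompleteSpace H]
  {S : H →ₗ.[ℂ] H}

/-- A selfadjoint operator is a formal adjoint of itself. -/
theorem isFormalAdjoint_self_of_isSelfAdjoint (hS : IsSelfAdjoint S) : S.IsFormalAdjoint S := by
  have h := adjoint_isFormalAdjoint hS.dense_domain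
  rwa [isSelfAdjoint_def.mp hS] at h

/-- A selfadjoint operator contains every pair `(y, w)` satisfying the adjoint relation. -/
theorem exists_apply_eq_of_isSelfAdjoint (hS : IsSelfAdjoint S) {y w : H}
    (h : ∀ x : S.domain, ⟪w, (x : H)⟫ = ⟪y, S x⟫) :
    ∃ hy : y ∈ S.domain, S ⟨y, hy⟩ = w := by
  have hy : y ∈ S.adjoint.domain := mem_adjoint_domain_of_exists y ⟨w, h⟩
  have hw : S.adjoint ⟨y, hy⟩ = w := adjoint_apply_eq hS.dense_domain ⟨y, hy⟩ h
  have hgraph : (y, w) ∈ S.adjoint.graph := (mem_graph_iff _).mpr ⟨⟨y, hy⟩, rfl, hw⟩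
  rw [isSelfAdjoint_def.mp hS] at hgraph
  obtain ⟨⟨z, hz⟩, rfl, hzw⟩ := (mem_graph_iff _).mp hgraph
  exact ⟨hz, hzw⟩

/-- If the adjoint relation between `y` and `w` holds on the graph-orthogonal complement of `φ`,
then it holds on all of `S.domain` after correcting by a multiple of `(S φ, -φ)`. -/
theorem exists_sub_smul_mem_of_isSelfAdjoint (hS : IsSelfAdjoint S) {φ : S.domain}
    (hφ : (φ : H) ≠ 0) {y w : H}
    (h : ∀ x : S.domain, ⟪(φ : H), (x : H)⟫ + ⟪S φ, S x⟫ = 0 → ⟪w, (x : H)⟫ = ⟪y, S x⟫) :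
    ∃ k : ℂ, ∃ hk : y - k • S φ ∈ S.domain, S ⟨y - k • S φ, hk⟩ = w + k • (φ : H) := by
  set n : ℂ := ⟪(φ : H), (φ : H)⟫ + ⟪S φ, S φ⟫ with hn
  have hn0 : n ≠ 0 := by
    have hpos : 0 < ‖(φ : H)‖ ^ 2 + ‖S φ‖ ^ 2 := by positivity
    have hnorm : n = ((‖(φ : H)‖ ^ 2 + ‖S φ‖ ^ 2 : ℝ) : ℂ) := by
      rw [hn, inner_self_eq_norm_sq_to_K, inner_self_eq_norm_sq_to_K]
      push_cast
      rfl
    exact hnorm ▸ Complex.ofReal_ne_zero.mpr hpos.ne'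
  refine ⟨starRingEnd ℂ ((⟪y, S φ⟫ - ⟪w, (φ : H)⟫) / n),
    exists_apply_eq_of_isSelfAdjoint hS fun x => ?_⟩
  have hx := h (x - ((⟪(φ : H), (x : H)⟫ + ⟪S φ, S x⟫) / n) • φ) (by
    simp only [map_sub, map_smul, Submodule.coe_sub, Submodule.coe_smul, inner_sub_right,
      inner_smul_right]
    field_simp
    rw [hn]
    ring)
  simp only [map_sub, map_smul, Submodule.coe_sub, Submodule.coe_smul, inner_sub_right,
    inner_smul_right] at hx
  simp only [inner_add_left, inner_sub_left, inner_smul_left, RingHomCompTriple.comp_apply,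
    RingHom.id_apply]
  linear_combination hx

end LinearPMap

theorem statement16
    {H : Type*} [NormedAddCommGroup H] [InnerProductSpace ℂ H] [CompleteSpace H]
    (S : H →ₗ.[ℂ] H) (hSdense : Dense (S.domain : Set H)) (hS : IsSelfAdjoint S)
    (φ : S.domain) (hφ : (φ : H) ≠ 0) (hSφ : S φ ∉ S.domain)
    (C : H →ₗ.[ℂ] H) (hCrestr : C ≤ S)
    (hCdom : ∀ x : H, x ∈ C.domain ↔ ∃ hx : x ∈ S.domain,
      ⟪(φ : H), x⟫ + ⟪S φ, S ⟨x, hx⟩⟫ = 0) :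
    C.adjoint.domain = S.domain ⊔ (ℂ ∙ (S φ)) ∧
    S.domain ⊓ (ℂ ∙ (S φ)) = ⊥ ∧
    (∀ (f : S.domain) (c : ℂ) (hmem : (f : H) + c • S φ ∈ C.adjoint.domain),
      C.adjoint ⟨(f : H) + c • S φ, hmem⟩ = S f - c • (φ : H)) := by
  have hS_symm := LinearPMap.isFormalAdjoint_self_of_isSelfAdjoint hS
  have hCapply (x : H) (hxC : x ∈ C.domain) (hxS : x ∈ S.domain) : C ⟨x, hxC⟩ = S ⟨x, hxS⟩ :=
    hCrestr.2 rfl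
  have hsmul (k : ℂ) (hk : k • S φ ∈ S.domain) : k = 0 := by
    by_contra hk0
    exact hSφ ((S.domain.smul_mem_iff hk0).mp hk)
  have hCdense : Dense (C.domain : Set H) := by
    rw [Submodule.dense_iff_topologicalClosure_eq_top,
      Submodule.topologicalClosure_eq_top_iff, Submodule.eq_bot_iff]
    intro w hw
    obtain ⟨k, hk, hkw⟩ := LinearPMap.exists_sub_smul_mem_of_isSelfAdjoint hS hφ
      (y := 0) (w := w) fun x hx => by
        rw [inner_zero_left]
        exact Submodule.inner_left_of_mem_orthogonal ((hCdom x).mpr ⟨x.2, hx⟩) hw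
    have hk0 : k = 0 := hsmul k (by simpa using hk)
    subst hk0
    have hzero : (⟨0 - (0 : ℂ) • S φ, hk⟩ : S.domain) = 0 := Subtype.ext (by simp)
    rw [hzero, LinearPMap.map_zero] at hkw
    simpa using hkw.symm
  have hadj (f : S.domain) (c : ℂ) (x : C.domain) :
      ⟪S f - c • (φ : H), (x : H)⟫ = ⟪(f : H) + c • S φ, C x⟫ := by
    obtain ⟨hxS, hx⟩ := (hCdom x).mp x.2
    rw [hCapply x x.2 hxS, inner_sub_left, inner_add_left, inner_smul_left, inner_smul_left,
      hS_symm f ⟨x, hxS⟩]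
    linear_combination (-starRingEnd ℂ c) * hx
  refine ⟨le_antisymm (fun y hy => ?_) (fun y hy => ?_), ?_, fun f c hmem => ?_⟩
  · obtain ⟨k, hk, -⟩ := LinearPMap.exists_sub_smul_mem_of_isSelfAdjoint hS hφ
      (y := y) (w := C.adjoint ⟨y, hy⟩) fun x hx => by
        have hxC : (x : H) ∈ C.domain := (hCdom x).mpr ⟨x.2, hx⟩
        rw [← hCapply x hxC x.2]
        exact LinearPMap.adjoint_isFormalAdjoint hCdense ⟨y, hy⟩ ⟨x, hxC⟩
    exact Submodule.mem_sup.mpr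
      ⟨_, hk, _, Submodule.smul_mem _ k (Submodule.mem_span_singleton_self _), by simp⟩
  · obtain ⟨f, hf, z, hz, rfl⟩ := Submodule.mem_sup.mp hy
    obtain ⟨c, rfl⟩ := Submodule.mem_span_singleton.mp hz
    exact LinearPMap.mem_adjoint_domain_of_exists _ ⟨_, hadj ⟨f, hf⟩ c⟩
  · rw [Submodule.eq_bot_iff]
    rintro z ⟨hzS, hz⟩
    obtain ⟨c, rfl⟩ := Submodule.mem_span_singleton.mp hz
    rw [hsmul c hzS, zero_smul]
  · exact LinearPMap.adjoint_apply_eq hCdense _ (hadj f c)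
end

section
/- Let S be a densely defined selfadjoint operator on a complex Hilbert space H, and let φ ∈ D(S) with φ ≠ 0 and Sφ ∉ D(S). Let C_φ be the restriction of S to D(C_φ) = {f ∈ D(S) : ⟨φ, f⟩ + ⟨Sφ, Sf⟩ = 0}, and let C_φ* be its adjoint, whose domain is D(S) ∔ span{Sφ} with action f + λSφ ↦ Sf − λφ. Then the deficiency spaces of C_φ are ker(C_φ* − i) = span{(S + i)φ} = span{Sφ + iφ} and ker(C_φ* + i) = span{(S − i)φ} = span{Sφ − iφ}; in particular both deficiency spaces are one-dimensional. -/
/- STATEMENT 17: With `S`, `φ`, `C_φ` as in Statement 15, the deficiency spaces of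
`C_φ` are `ker(C_φ* - i) = span{Sφ + iφ}` and `ker(C_φ* + i) = span{Sφ - iφ}`;
in particular both are one-dimensional (the spanning vectors are nonzero). -/

open scoped ComplexInnerProductSpace

namespace LinearPMap

variable {H : Type*} [NormedAddCommGroup H] [InnerProductSpace ℂ H]
  {S C : H →ₗ.[ℂ] H} {φ : S.domain}

/-- A linear functional on `S.domain` vanishing on the kernel of the graph inner product with `φ`
is a multiple of that inner product. -/
theorem exists_eq_mul_graph_inner (hφ : (φ : H) ≠ 0) (k : S.domain →ₗ[ℂ] ℂ)
    (hk : ∀ f : S.domain, ⟪(φ : H), (f : H)⟫ + ⟪S φ, S f⟫ = 0 → k f = 0) :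
    ∃ c : ℂ, ∀ f : S.domain, k f = c * (⟪(φ : H), (f : H)⟫ + ⟪S φ, S f⟫) := by
  set l : S.domain → ℂ := fun f => ⟪(φ : H), (f : H)⟫ + ⟪S φ, S f⟫ with hl
  have hne : l φ ≠ 0 := by
    simp only [hl, inner_self_eq_norm_sq_to_K]
    have : 0 < ‖(φ : H)‖ := norm_pos_iff.2 hφ
    have h2 : ‖(φ : H)‖ ^ 2 + ‖S φ‖ ^ 2 ≠ 0 := by positivity
    rw [← Complex.ofReal_ne_zero] at h2
    simpa using h2
  refine ⟨k φ / l φ, fun f => ?_⟩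
  have h := hk (f - (l f / l φ) • φ) (by
    have : l f - (l f / l φ) * l φ = 0 := by field_simp; ring
    rw [← this]
    simp only [hl, map_sub, map_smul, Submodule.coe_sub, Submodule.coe_smul, inner_sub_right,
      inner_smul_right]
    ring)
  rw [_root_.map_sub, _root_.map_smul, sub_eq_zero, smul_eq_mul] at h
  change k f = k φ / l φ * l f
  rw [h]
  ring

variable [CompleteSpace H]

theorem mem_domain_of_isSelfAdjoint (hS : IsSelfAdjoint S) {u w : H}
    (h : ∀ f : S.domain, ⟪w, (f : H)⟫ = ⟪u, S f⟫) :
    ∃ hu : u ∈ S.domain, S ⟨u, hu⟩ = w := by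
  have hu' : u ∈ S.adjoint.domain := mem_adjoint_domain_of_exists u ⟨w, h⟩
  have hw : S.adjoint ⟨u, hu'⟩ = w := adjoint_apply_eq hS.dense_domain _ h
  have hm : (u, w) ∈ S.adjoint.graph := mem_graph_iff _ |>.2 ⟨⟨u, hu'⟩, rfl, hw⟩
  rw [isSelfAdjoint_def.mp hS, mem_graph_iff] at hm
  obtain ⟨⟨y, hy⟩, rfl, h2⟩ := hm
  exact ⟨hy, h2⟩

theorem inner_symm_of_isSelfAdjoint (hS : IsSelfAdjoint S) (x y : S.domain) :
    ⟪S x, (y : H)⟫ = ⟪(x : H), S y⟫ := by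
  have h := adjoint_isFormalAdjoint hS.dense_domain
  rw [isSelfAdjoint_def.mp hS] at h
  exact h x y

/-- A selfadjoint operator has no eigenvector for an eigenvalue `z` with `z * z = -1`. -/
theorem eq_zero_of_isSelfAdjoint_of_eigen (hS : IsSelfAdjoint S) {z : ℂ} (hz : z * z = -1)
    (v : S.domain) (hv : S v = z • (v : H)) : (v : H) = 0 := by
  have h := inner_symm_of_isSelfAdjoint hS v v
  rw [hv, inner_smul_left, inner_smul_right] at h
  by_contra hne
  have hc : (starRingEnd ℂ) z = z := mul_right_cancel₀ (inner_self_ne_zero.2 hne) h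
  have h1 := Complex.mul_conj z
  rw [hc, hz] at h1
  have h2 : (-1 : ℝ) = Complex.normSq z := by exact_mod_cast h1
  linarith [Complex.normSq_nonneg z]

theorem dense_domain_graph_inner_ker (hS : IsSelfAdjoint S) (hφ : (φ : H) ≠ 0)
    (hSφ : S φ ∉ S.domain)
    (hCdom : ∀ x : H, x ∈ C.domain ↔ ∃ hx : x ∈ S.domain,
      ⟪(φ : H), x⟫ + ⟪S φ, S ⟨x, hx⟩⟫ = 0) :
    Dense (C.domain : Set H) := by
  rw [Submodule.dense_iff_topologicalClosure_eq_top, Submodule.topologicalClosure_eq_top_iff,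
    Submodule.eq_bot_iff]
  intro h hh
  rw [Submodule.mem_orthogonal'] at hh
  obtain ⟨c, hc⟩ := exists_eq_mul_graph_inner hφ ((innerₛₗ ℂ h).comp S.domain.subtype)
    fun f hf => hh f ((hCdom f).2 ⟨f.2, hf⟩)
  simp only [LinearMap.comp_apply, Submodule.subtype_apply, innerₛₗ_apply_apply] at hc
  by_cases hc0 : c = 0
  · exact hS.dense_domain.eq_zero_of_inner_left ℂ fun v hv => by simpa [hc0] using hc ⟨v, hv⟩
  · refine absurd (mem_domain_of_isSelfAdjoint hS (u := S φ)
      (w := (starRingEnd ℂ c)⁻¹ • h - (φ : H)) fun f => ?_).1 hSφ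
    rw [inner_sub_left, inner_smul_left, hc f, map_inv₀, Complex.conj_conj]
    field_simp
    ring

theorem adjoint_eigenspace_eq_span (hS : IsSelfAdjoint S) (hφ : (φ : H) ≠ 0)
    (hSφ : S φ ∉ S.domain) (hCrestr : C ≤ S)
    (hCdom : ∀ x : H, x ∈ C.domain ↔ ∃ hx : x ∈ S.domain,
      ⟪(φ : H), x⟫ + ⟪S φ, S ⟨x, hx⟩⟫ = 0) {z : ℂ} (hz : z * z = -1) :
    {g : H | ∃ hg : g ∈ C.adjoint.domain, C.adjoint ⟨g, hg⟩ = z • g} =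
      ((ℂ ∙ (S φ + z • (φ : H)) : Submodule ℂ H) : Set H) := by
  have hCd := dense_domain_graph_inner_ker hS hφ hSφ hCdom
  ext g
  simp only [Set.mem_ofPred_eq, SetLike.mem_coe, Submodule.mem_span_singleton]
  constructor
  · rintro ⟨hg, hgz⟩
    obtain ⟨c, hc⟩ := exists_eq_mul_graph_inner hφ
      ((innerₛₗ ℂ g).comp S.toFun - (innerₛₗ ℂ (z • g)).comp S.domain.subtype)
      fun f hf => by
        have hfC : (f : H) ∈ C.domain := (hCdom f).2 ⟨f.2, hf⟩
        have h := adjoint_isFormalAdjoint hCd ⟨g, hg⟩ ⟨f, hfC⟩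
        rw [hgz, hCrestr.2 (x := ⟨f, hfC⟩) (y := f) rfl] at h
        exact sub_eq_zero.2 h.symm
    replace hc : ∀ f : S.domain, ⟪g, S f⟫ - ⟪z • g, (f : H)⟫ =
      c * (⟪(φ : H), (f : H)⟫ + ⟪S φ, S f⟫) := hc
    set a := (starRingEnd ℂ) c with ha
    obtain ⟨hu, hSu⟩ := mem_domain_of_isSelfAdjoint hS (u := g - a • S φ)
      (w := z • g + a • (φ : H)) fun f => by
        rw [inner_add_left, inner_sub_left, inner_smul_left (φ : H), inner_smul_left (S φ), ha,
          Complex.conj_conj]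
        linear_combination -hc f
    have hv := eq_zero_of_isSelfAdjoint_of_eigen hS hz (⟨g - a • S φ, hu⟩ - (a * z) • φ) (by
      rw [map_sub, map_smul, hSu, Submodule.coe_sub, Submodule.coe_smul]
      linear_combination (norm := module) a • congrArg (· • (φ : H)) hz)
    refine ⟨a, ?_⟩
    rw [Submodule.coe_sub, Submodule.coe_smul] at hv
    rw [← sub_eq_zero, ← neg_eq_zero, ← hv]
    module
  · rintro ⟨a, rfl⟩
    have key : ∀ f : C.domain, ⟪z • a • (S φ + z • (φ : H)), (f : H)⟫ =
        ⟪a • (S φ + z • (φ : H)), C f⟫ := fun f => by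
      obtain ⟨hf, hf0⟩ := (hCdom f).1 f.2
      rw [hCrestr.2 (x := f) (y := ⟨f, hf⟩) rfl]
      have hsym := inner_symm_of_isSelfAdjoint hS φ ⟨f, hf⟩
      have hz' : (starRingEnd ℂ) z * (starRingEnd ℂ) z = -1 := by
        rw [← map_mul, hz, _root_.map_neg, map_one]
      simp only [inner_smul_left, inner_add_left]
      linear_combination (starRingEnd ℂ) a * ((starRingEnd ℂ) z * hsym - hf0 +
        ⟪(φ : H), (f : H)⟫ * hz')
    exact ⟨mem_adjoint_domain_of_exists _ ⟨_, key⟩, adjoint_apply_eq hCd _ key⟩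

end LinearPMap

theorem statement17
    {H : Type*} [NormedAddCommGroup H] [InnerProductSpace ℂ H] [CompleteSpace H]
    (S : H →ₗ.[ℂ] H) (hSdense : Dense (S.domain : Set H)) (hS : IsSelfAdjoint S)
    (φ : S.domain) (hφ : (φ : H) ≠ 0) (hSφ : S φ ∉ S.domain)
    (C : H →ₗ.[ℂ] H) (hCrestr : C ≤ S)
    (hCdom : ∀ x : H, x ∈ C.domain ↔ ∃ hx : x ∈ S.domain,
      ⟪(φ : H), x⟫ + ⟪S φ, S ⟨x, hx⟩⟫ = 0) :
    {g : H | ∃ hg : g ∈ C.adjoint.domain, C.adjoint ⟨g, hg⟩ = Complex.I • g} =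
      ((ℂ ∙ (S φ + Complex.I • (φ : H)) : Submodule ℂ H) : Set H) ∧
    {g : H | ∃ hg : g ∈ C.adjoint.domain, C.adjoint ⟨g, hg⟩ = -(Complex.I • g)} =
      ((ℂ ∙ (S φ - Complex.I • (φ : H)) : Submodule ℂ H) : Set H) ∧
    S φ + Complex.I • (φ : H) ≠ 0 ∧ S φ - Complex.I • (φ : H) ≠ 0 := by
  have hplus := LinearPMap.adjoint_eigenspace_eq_span hS hφ hSφ hCrestr hCdom Complex.I_mul_I
  have hminus := LinearPMap.adjoint_eigenspace_eq_span hS hφ hSφ hCrestr hCdom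
    (z := -Complex.I) (by rw [neg_mul_neg, Complex.I_mul_I])
  simp only [neg_smul, ← sub_eq_add_neg] at hminus
  refine ⟨hplus, hminus, fun h => hSφ ?_, fun h => hSφ ?_⟩
  · rw [eq_neg_of_add_eq_zero_left h]
    exact S.domain.neg_mem (S.domain.smul_mem _ φ.2)
  · rw [sub_eq_zero.1 h]
    exact S.domain.smul_mem _ φ.2
end

section
/- The improper Riemann (Lebesgue) integral over the real line satisfies (1/π) ∫_{−∞}^{∞} (1 − cos k)/(k² + k⁴) dk = 1/e, where e is Euler's number. -/
/- STATEMENT 18: `(1/π) ∫_ℝ (1 - cos k)/(k² + k⁴) dk = 1/e`. -/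

open MeasureTheory

open scoped FourierTransform

theorem integrable_cexp_neg_abs : Integrable fun x : ℝ ↦ Complex.exp (-(|x| : ℝ)) := by
  rw [← integrableOn_univ, ← Set.Iic_union_Ioi (a := (0 : ℝ))]
  refine IntegrableOn.union ?_ ?_
  · refine (integrableOn_exp_mul_complex_Iic (a := 1) (by simp) 0).congr_fun ?_ measurableSet_Iic
    intro x hx
    simp [abs_of_nonpos (Set.mem_Iic.1 hx)]
  · refine (integrableOn_exp_mul_complex_Ioi (a := -1) (by simp) 0).congr_fun ?_ measurableSet_Ioi
    intro x hx
    simp [abs_of_pos (Set.mem_Ioi.1 hx)]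

theorem fourier_cexp_neg_abs (w : ℝ) :
    𝓕 (fun x : ℝ ↦ Complex.exp (-(|x| : ℝ))) w = ((2 * (1 + (2 * Real.pi * w) ^ 2)⁻¹ : ℝ) : ℂ) := by
  have h_int := (Real.fourierIntegral_convergent_iff (μ := volume) w).2 integrable_cexp_neg_abs
  have h_exp : Integrable fun x : ℝ ↦
      Complex.exp (↑(-2 * Real.pi * x * w) * Complex.I) • Complex.exp (-(|x| : ℝ)) := by
    refine h_int.congr (.of_forall fun x ↦ ?_)
    simp [Circle.smul_def, Real.fourierChar_apply]
    ring_nf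
  rw [Real.fourier_real_eq_integral_exp_smul,
    ← intervalIntegral.integral_Iic_add_Ioi (b := 0) h_exp.integrableOn h_exp.integrableOn]
  have h₁ : ∫ x in Set.Iic (0 : ℝ),
      Complex.exp (↑(-2 * Real.pi * x * w) * Complex.I) • Complex.exp (-(|x| : ℝ)) =
      1 / (1 - 2 * Real.pi * w * Complex.I) := by
    have := integral_exp_mul_complex_Iic (a := 1 - 2 * Real.pi * w * Complex.I) (by simp) 0
    simp only [Complex.ofReal_zero, mul_zero, Complex.exp_zero] at this
    rw [← this]
    refine setIntegral_congr_fun measurableSet_Iic fun x hx ↦ ?_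
    rw [smul_eq_mul, ← Complex.exp_add, abs_of_nonpos hx]
    push_cast
    ring_nf
  have h₂ : ∫ x in Set.Ioi (0 : ℝ),
      Complex.exp (↑(-2 * Real.pi * x * w) * Complex.I) • Complex.exp (-(|x| : ℝ)) =
      1 / (1 + 2 * Real.pi * w * Complex.I) := by
    have := integral_exp_mul_complex_Ioi (a := -(1 + 2 * Real.pi * w * Complex.I)) (by simp) 0
    simp only [Complex.ofReal_zero, mul_zero, Complex.exp_zero, neg_div_neg_eq] at this
    rw [← this]
    refine setIntegral_congr_fun measurableSet_Ioi fun x hx ↦ ?_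
    rw [smul_eq_mul, ← Complex.exp_add, abs_of_pos hx]
    push_cast
    ring_nf
  rw [h₁, h₂]
  have n₁ : (1 - 2 * Real.pi * w * Complex.I : ℂ) ≠ 0 := fun h ↦ by
    simpa using congrArg Complex.re h
  have n₂ : (1 + 2 * Real.pi * w * Complex.I : ℂ) ≠ 0 := fun h ↦ by
    simpa using congrArg Complex.re h
  have n₃ : (1 + (2 * Real.pi * w) ^ 2 : ℂ) =
      (1 - 2 * Real.pi * w * Complex.I) * (1 + 2 * Real.pi * w * Complex.I) := by
    linear_combination (2 * Real.pi * w : ℂ) ^ 2 * Complex.I_sq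
  push_cast
  rw [n₃]
  field_simp
  ring

theorem integral_cos_mul_inv_one_add_sq (t : ℝ) :
    ∫ k : ℝ, Real.cos (t * k) * (1 + k ^ 2)⁻¹ = Real.pi * Real.exp (-|t|) := by
  have hF : 𝓕 (fun x : ℝ ↦ Complex.exp (-(|x| : ℝ))) =
      fun w : ℝ ↦ ((2 * (1 + (2 * Real.pi * w) ^ 2)⁻¹ : ℝ) : ℂ) :=
    funext fourier_cexp_neg_abs
  have hpi : 2 * Real.pi ≠ 0 := by positivity
  have hFint : Integrable (𝓕 (fun x : ℝ ↦ Complex.exp (-(|x| : ℝ)))) := by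
    rw [hF]
    exact ((integrable_inv_one_add_sq.comp_mul_left' hpi).const_mul 2).ofReal
  have hcont : Continuous fun x : ℝ ↦ Complex.exp (-(|x| : ℝ)) := by fun_prop
  have h := congrFun (hcont.fourierInv_fourier_eq integrable_cexp_neg_abs hFint) t
  rw [hF, Real.fourierInv_eq'] at h
  have h_int : Integrable fun v : ℝ ↦ Complex.exp (↑(2 * Real.pi * inner ℝ v t) * Complex.I) •
      ((2 * (1 + (2 * Real.pi * v) ^ 2)⁻¹ : ℝ) : ℂ) := by
    rw [hF] at hFint
    refine hFint.bdd_mul (c := 1)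
      (Continuous.aestronglyMeasurable (by fun_prop)) (.of_forall fun v ↦ ?_)
    exact (Complex.norm_exp_ofReal_mul_I _).le
  have hre := congrArg Complex.re h
  rw [← RCLike.re_to_complex, ← integral_re h_int] at hre
  have hval : ∀ v : ℝ, RCLike.re (Complex.exp (↑(2 * Real.pi * inner ℝ v t) * Complex.I) •
      ((2 * (1 + (2 * Real.pi * v) ^ 2)⁻¹ : ℝ) : ℂ)) =
      2 * (fun k : ℝ ↦ Real.cos (t * k) * (1 + k ^ 2)⁻¹) (2 * Real.pi * v) := by
    intro v
    rw [smul_eq_mul, RCLike.re_to_complex, Complex.re_mul_ofReal, Complex.exp_ofReal_mul_I_re]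
    simp only [RCLike.inner_apply, conj_trivial]
    ring_nf
  simp_rw [hval] at hre
  rw [integral_const_mul, Measure.integral_comp_mul_left
    (fun k : ℝ ↦ Real.cos (t * k) * (1 + k ^ 2)⁻¹) (2 * Real.pi), ← Complex.ofReal_neg,
    Complex.exp_ofReal_re, abs_of_pos (by positivity), smul_eq_mul] at hre
  rw [← hre]
  field_simp

theorem hasDerivAt_one_sub_mul_sin_sub_cos {k : ℝ} (hk : k ≠ 0) (t : ℝ) :
    HasDerivAt (fun t ↦ (1 - t) * Real.sin (t * k) / k - Real.cos (t * k) / k ^ 2)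
      ((1 - t) * Real.cos (t * k)) t := by
  have h := (hasDerivAt_id t).mul_const k
  have := ((((hasDerivAt_id t).const_sub 1).mul h.sin).div_const k).sub (h.cos.div_const (k ^ 2))
  refine this.congr_deriv ?_
  simp only [id]
  field_simp
  ring

theorem integral_one_sub_mul_cos {k : ℝ} (hk : k ≠ 0) :
    ∫ t in (0 : ℝ)..1, (1 - t) * Real.cos (t * k) = (1 - Real.cos k) / k ^ 2 := by
  rw [intervalIntegral.integral_eq_sub_of_hasDerivAt
    (fun t _ ↦ hasDerivAt_one_sub_mul_sin_sub_cos hk t)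
    (Continuous.intervalIntegrable (by fun_prop) _ _)]
  simp
  ring

theorem integral_one_sub_mul_exp_neg :
    ∫ t in (0 : ℝ)..1, (1 - t) * Real.exp (-t) = Real.exp (-1) := by
  rw [intervalIntegral.integral_eq_sub_of_hasDerivAt (f := fun t ↦ t * Real.exp (-t)) (fun t _ ↦ ?_)
    (Continuous.intervalIntegrable (by fun_prop) _ _)]
  · simp
  · refine ((hasDerivAt_id t).mul (hasDerivAt_neg t).exp).congr_deriv ?_
    simp only [id]
    ring

theorem statement18 :
    (1 / Real.pi) * ∫ k : ℝ, (1 - Real.cos k) / (k ^ 2 + k ^ 4) = 1 / Real.exp 1 := by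
  have hk : ∫ k : ℝ, (1 - Real.cos k) / (k ^ 2 + k ^ 4) =
      ∫ k : ℝ, ∫ t in (0 : ℝ)..1, (1 - t) * (Real.cos (t * k) * (1 + k ^ 2)⁻¹) := by
    refine integral_congr_ae ?_
    filter_upwards [Measure.ae_ne volume (0 : ℝ)] with k hk
    simp_rw [← mul_assoc]
    rw [intervalIntegral.integral_mul_const, integral_one_sub_mul_cos hk]
    field_simp
  have h_int : Integrable (Function.uncurry fun k t : ℝ ↦
      (1 - t) * (Real.cos (t * k) * (1 + k ^ 2)⁻¹))
      (volume.prod (volume.restrict (Set.Ioc (0 : ℝ) 1))) := by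
    have hb : Integrable (fun t : ℝ ↦ 1 - t) (volume.restrict (Set.Ioc (0 : ℝ) 1)) :=
      (Continuous.integrableOn_Icc (by fun_prop)).mono_set Set.Ioc_subset_Icc_self
    have hcos : Continuous fun p : ℝ × ℝ ↦ Real.cos (p.2 * p.1) := by fun_prop
    refine ((integrable_inv_one_add_sq.mul_prod hb).bdd_mul (c := 1)
      hcos.aestronglyMeasurable (.of_forall fun p ↦ Real.abs_cos_le_one _)).congr
      (.of_forall fun p ↦ ?_)
    simp only [Function.uncurry]
    ring
  have hswap : ∫ k : ℝ, ∫ t in (0 : ℝ)..1, (1 - t) * (Real.cos (t * k) * (1 + k ^ 2)⁻¹) =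
      ∫ t in (0 : ℝ)..1, ∫ k : ℝ, (1 - t) * (Real.cos (t * k) * (1 + k ^ 2)⁻¹) := by
    simp_rw [intervalIntegral.integral_of_le zero_le_one]
    exact integral_integral_swap h_int
  have hinner : ∫ t in (0 : ℝ)..1, ∫ k : ℝ, (1 - t) * (Real.cos (t * k) * (1 + k ^ 2)⁻¹) =
      ∫ t in (0 : ℝ)..1, Real.pi * ((1 - t) * Real.exp (-t)) := by
    refine intervalIntegral.integral_congr fun t ht ↦ ?_
    rw [Set.uIcc_of_le zero_le_one] at ht
    simp only [integral_const_mul, integral_cos_mul_inv_one_add_sq, abs_of_nonneg ht.1]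
    ring
  rw [hk, hswap, hinner, intervalIntegral.integral_const_mul, integral_one_sub_mul_exp_neg,
    Real.exp_neg]
  field_simp
end
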